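/- For every ε > 0 there is a constant C_ε such that the following holds with r = 3 + ε: for every Schwartz function f : ℝ⁴ → ℂ of unit frequency, every 0 < μ ≤ 1, and the partition {Q_α}_{α∈ℤ⁴} of ℝ⁴ into cubes of side length 1/μ, the half-wave evolution u(t,x) = e^{it√(−Δ)}f(x) satisfies ( ∫_ℝ ( Σ_{α∈ℤ⁴} ‖u(t,·)‖_{L²(Q_α)}^{r} )^{2/r} dt )^{1/2} ≤ C_ε μ^{−(1/2+ε)} ( ‖f‖_{L²(ℝ⁴)} + Σ_{1≤i<j≤4} ‖Ω_{ij} f‖_{L²(ℝ⁴)} ). -/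

import Mathlib

open MeasureTheory Complex
open scoped FourierTransform RealInnerProductSpace ENNReal BigOperators

noncomputable section

/-- Four-dimensional Euclidean space. -/
abbrev Sp : Type := EuclideanSpace ℝ (Fin 4)

/-- The half-wave propagator `e^{it√(−Δ)}f(x) = ∫ e^{2πi(t|ξ| + x·ξ)} f̂(ξ) dξ`. -/
def halfWave (f : Sp → ℂ) (t : ℝ) (x : Sp) : ℂ :=
  ∫ ξ : Sp, Complex.exp (2 * Real.pi * Complex.I * ((t * ‖ξ‖ + ⟪x, ξ⟫ : ℝ) : ℂ)) * 𝓕 f ξ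

/-- `f` has unit frequency: `f̂` is supported in the annulus `{1/2 ≤ |ξ| ≤ 2}`. -/
def UnitFrequency (f : Sp → ℂ) : Prop :=
  ∀ ξ : Sp, 𝓕 f ξ ≠ 0 → 1/2 ≤ ‖ξ‖ ∧ ‖ξ‖ ≤ 2

/-- The lattice cube `Q_α = {x : μx − α ∈ [0,1)⁴}` of side length `1/μ`. -/
def cube (μ : ℝ) (a : Fin 4 → ℤ) : Set Sp :=
  {x : Sp | ∀ i : Fin 4, (a i : ℝ) ≤ μ * x i ∧ μ * x i < a i + 1}

/-- The local `L²` norm `‖h‖_{L²(Q_α)}`. -/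
def cubeNorm (μ : ℝ) (a : Fin 4 → ℤ) (h : Sp → ℂ) : ℝ≥0∞ :=
  (∫⁻ x in cube μ a, (‖h x‖₊ : ℝ≥0∞) ^ (2:ℝ)) ^ (1/2 : ℝ)

/-- The angular momentum (rotation) vector fields `Ω_{ij}f(x) = x_i ∂_j f − x_j ∂_i f`. -/
def Omega (i j : Fin 4) (f : Sp → ℂ) (x : Sp) : ℂ :=
  (x i : ℂ) * fderiv ℝ f x (EuclideanSpace.single j (1:ℝ))
    - (x j : ℂ) * fderiv ℝ f x (EuclideanSpace.single i (1:ℝ))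

/-- Schur's test for a convolution kernel. -/
lemma lintegral_conv_kernel_le (G : Sp → ℝ≥0∞) (hG : Measurable G)
    (a : Sp → ℝ≥0∞) (ha : Measurable a) :
    ∫⁻ p : Sp × Sp, G (p.1 - p.2) * (a p.1 * a p.2) ≤
      2 * (∫⁻ x, G x) * ∫⁻ x, a x ^ 2 := by
  have key : ∀ x y : ℝ≥0∞, x * y ≤ x ^ 2 + y ^ 2 := by
    intro x y
    rcases le_total x y with h | h
    · calc x * y ≤ y * y := by gcongr
        _ = y ^ 2 := (sq y).symm
        _ ≤ _ := le_add_self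
    · calc x * y ≤ x * x := by gcongr
        _ = x ^ 2 := (sq x).symm
        _ ≤ _ := le_self_add
  have h1 : ∫⁻ p : Sp × Sp, G (p.1 - p.2) * a p.1 ^ 2 = (∫⁻ x, G x) * ∫⁻ x, a x ^ 2 := by
    rw [Measure.volume_eq_prod, lintegral_prod _ (by fun_prop)]
    have : ∀ x : Sp, ∫⁻ y : Sp, G (x - y) * a x ^ 2 = (∫⁻ x, G x) * a x ^ 2 := by
      intro x
      rw [lintegral_mul_const _ (by fun_prop), lintegral_sub_left_eq_self (fun y => G y) x]
    simp only [this]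
    rw [lintegral_const_mul _ (by fun_prop)]
  have h2 : ∫⁻ p : Sp × Sp, G (p.1 - p.2) * a p.2 ^ 2 = (∫⁻ x, G x) * ∫⁻ x, a x ^ 2 := by
    rw [Measure.volume_eq_prod, lintegral_prod_symm _ (by fun_prop)]
    have : ∀ y : Sp, ∫⁻ x : Sp, G (x - y) * a y ^ 2 = (∫⁻ x, G x) * a y ^ 2 := by
      intro y
      rw [lintegral_mul_const _ (by fun_prop), lintegral_sub_right_eq_self (fun y => G y) y]
    simp only [this]
    rw [lintegral_const_mul _ (by fun_prop)]
  calc ∫⁻ p : Sp × Sp, G (p.1 - p.2) * (a p.1 * a p.2)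
      ≤ ∫⁻ p : Sp × Sp, (G (p.1 - p.2) * a p.1 ^ 2 + G (p.1 - p.2) * a p.2 ^ 2) := by
        gcongr with p
        rw [← mul_add]
        gcongr
        exact key _ _
    _ = 2 * (∫⁻ x, G x) * ∫⁻ x, a x ^ 2 := by
        rw [lintegral_add_left (by fun_prop), h1, h2]; ring

/-- The oscillatory extension operator with phase `ψ`. -/
def oscExt (ψ : Sp → Sp) (H : Sp → ℂ) (z : Sp) : ℂ :=
  ∫ ξ, cexp (2 * Real.pi * I * (⟪z, ψ ξ⟫ : ℝ)) * H ξ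

lemma norm_cexp_two_pi_I (r : ℝ) : ‖cexp (2 * Real.pi * I * (r : ℂ))‖ = 1 := by
  have : (2 * Real.pi * I * (r : ℂ)) = ((2 * Real.pi * r : ℝ) : ℂ) * I := by push_cast; ring
  rw [this, norm_exp_ofReal_mul_I]

lemma oscExt_mul_conj (ψ : Sp → Sp) (H : Sp → ℂ) (z : Sp) :
    oscExt ψ H z * (starRingEnd ℂ) (oscExt ψ H z) =
      ∫ p : Sp × Sp, cexp (2 * Real.pi * I * (⟪z, ψ p.1 - ψ p.2⟫ : ℝ)) *
        (H p.1 * (starRingEnd ℂ) (H p.2)) := by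
  unfold oscExt
  rw [← integral_conj, ← integral_prod_mul, ← Measure.volume_eq_prod]
  congr 1
  ext p
  rw [map_mul (starRingEnd ℂ), ← Complex.exp_conj, inner_sub_right]
  have : (starRingEnd ℂ) (2 * Real.pi * I * (⟪z, ψ p.2⟫ : ℝ)) =
      -(2 * Real.pi * I * (⟪z, ψ p.2⟫ : ℝ)) := by
    simp [Complex.conj_ofReal, Complex.conj_ofNat]
  rw [this]
  push_cast
  rw [mul_sub, sub_eq_add_neg, Complex.exp_add]
  ring

lemma gaussian_oscExt_le {ψ : Sp → Sp} {H : Sp → ℂ} (hψ : Measurable ψ) (hHm : Measurable H)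
    (hH : Integrable H) {c : ℝ} (hc : 0 < c)
    (hexp : ∀ ξ η, H ξ ≠ 0 → H η ≠ 0 → c * ‖ξ - η‖ ≤ ‖ψ ξ - ψ η‖) {b : ℝ} (hb : 0 < b) :
    ∫⁻ z, ENNReal.ofReal (Real.exp (-b * ‖z‖ ^ 2)) * ‖oscExt ψ H z‖ₑ ^ 2 ≤
      2 * ENNReal.ofReal (c⁻¹ ^ 4) * ∫⁻ ξ, ‖H ξ‖ₑ ^ 2 := by
  set K : Sp → Sp × Sp → ℂ := fun z p => cexp (-(b : ℂ) * ‖z‖ ^ 2) *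
    (cexp (2 * Real.pi * I * (⟪z, ψ p.1 - ψ p.2⟫ : ℝ)) *
        (H p.1 * (starRingEnd ℂ) (H p.2))) with hK
  have hgauss : Integrable (fun z : Sp => cexp (-(b : ℂ) * ‖z‖ ^ 2)) := by
    simpa using GaussianFourier.integrable_cexp_neg_mul_sq_norm_add (V := Sp) (b := (b : ℂ))
      (by simpa using hb) 0 0
  have hHH : Integrable (fun p : Sp × Sp => H p.1 * (starRingEnd ℂ) (H p.2)) := by
    have := hH.mul_prod (ν := (volume : Measure Sp)) (g := fun x => (starRingEnd ℂ) (H x))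
      (RCLike.conjCLE (K := ℂ) |>.toContinuousLinearMap.integrable_comp hH)
    exact this
  have hKint : Integrable (Function.uncurry K) := by
    have h0 := hgauss.mul_prod (ν := (volume : Measure (Sp × Sp))) hHH
    refine Integrable.mono h0 ?_ ?_
    · apply Measurable.aestronglyMeasurable
      simp only [hK, Function.uncurry_def]
      fun_prop
    · refine Filter.Eventually.of_forall fun q => ?_
      simp only [hK, Function.uncurry_def, norm_mul, norm_cexp_two_pi_I, one_mul, le_refl]
  have hFz : ∀ z, ∫ p, K z p = ((Real.exp (-b * ‖z‖ ^ 2) * ‖oscExt ψ H z‖ ^ 2 : ℝ) : ℂ) := by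
    intro z
    simp only [hK]
    rw [integral_const_mul, ← oscExt_mul_conj, Complex.mul_conj, Complex.normSq_eq_norm_sq]
    push_cast
    rfl
  have hre : Integrable (fun z => Real.exp (-b * ‖z‖ ^ 2) * ‖oscExt ψ H z‖ ^ 2) := by
    have h1 : Integrable (fun z => ∫ p, K z p) := hKint.integral_prod_left
    simp only [hFz] at h1
    exact h1.re
  have hleft : ∫⁻ z, ENNReal.ofReal (Real.exp (-b * ‖z‖ ^ 2)) * ‖oscExt ψ H z‖ₑ ^ 2 =
      ‖∫ z, ∫ p, K z p‖ₑ := by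
    have e1 : ∀ z, ENNReal.ofReal (Real.exp (-b * ‖z‖ ^ 2)) * ‖oscExt ψ H z‖ₑ ^ 2 =
        ENNReal.ofReal (Real.exp (-b * ‖z‖ ^ 2) * ‖oscExt ψ H z‖ ^ 2) := by
      intro z
      rw [ENNReal.ofReal_mul (by positivity), ENNReal.ofReal_pow (by positivity), ofReal_norm]
    simp only [e1, hFz]
    rw [← ofReal_integral_eq_lintegral_ofReal hre
      (Filter.Eventually.of_forall fun z => by positivity)]
    have e2 : ∫ z, ((Real.exp (-b * ‖z‖ ^ 2) * ‖oscExt ψ H z‖ ^ 2 : ℝ) : ℂ) =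
        ((∫ z, Real.exp (-b * ‖z‖ ^ 2) * ‖oscExt ψ H z‖ ^ 2 : ℝ) : ℂ) := integral_ofReal
    rw [e2, ← ofReal_norm, Complex.norm_of_nonneg]
    exact integral_nonneg fun z => by positivity
  rw [hleft, integral_integral_swap hKint]
  have hinner : ∀ p : Sp × Sp, ∫ z, K z p = ((Real.pi / b) ^ 2 *
      Real.exp (-(Real.pi ^ 2 / b) * ‖ψ p.1 - ψ p.2‖ ^ 2) : ℝ) *
        (H p.1 * (starRingEnd ℂ) (H p.2)) := by
    intro p
    have := GaussianFourier.integral_cexp_neg_mul_sq_norm_add (V := Sp) (b := (b : ℂ))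
      (by simpa using hb) (2 * Real.pi * I) (ψ p.1 - ψ p.2)
    simp only [hK, ← mul_assoc, ← Complex.exp_add]
    rw [integral_mul_const]
    rw [integral_mul_const]
    congr 2
    have hcomm : ∀ z : Sp, ⟪z, ψ p.1 - ψ p.2⟫ = ⟪ψ p.1 - ψ p.2, z⟫ :=
      fun z => real_inner_comm _ _
    simp_rw [hcomm]
    rw [this]
    have hb' : (b : ℂ) ≠ 0 := by exact_mod_cast hb.ne'
    push_cast
    congr 1
    · simp only [finrank_euclideanSpace, Fintype.card_fin]
      norm_num
    · congr 1
      field_simp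
      rw [I_sq]
      ring
  simp only [hinner]
  set G : Sp → ℝ≥0∞ := fun x => ENNReal.ofReal ((Real.pi / b) ^ 2 *
      Real.exp (-(Real.pi ^ 2 / b * c ^ 2) * ‖x‖ ^ 2)) with hGdef
  have hG : ∫⁻ x, G x = ENNReal.ofReal (c⁻¹ ^ 4) := by
    have hb2 : 0 < Real.pi ^ 2 / b * c ^ 2 := by positivity
    have hi : Integrable (fun x : Sp => Real.exp (-(Real.pi ^ 2 / b * c ^ 2) * ‖x‖ ^ 2)) := by
      have := GaussianFourier.integrable_cexp_neg_mul_sq_norm_add (V := Sp)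
        (b := ((Real.pi ^ 2 / b * c ^ 2 : ℝ) : ℂ)) (by rw [Complex.ofReal_re]; exact hb2) 0 0
      simp only [zero_mul, add_zero] at this
      refine this.re.congr (Filter.Eventually.of_forall fun x => ?_)
      change (cexp _).re = _
      have : cexp (-((Real.pi ^ 2 / b * c ^ 2 : ℝ) : ℂ) * (‖x‖ : ℂ) ^ 2) =
          ((Real.exp (-(Real.pi ^ 2 / b * c ^ 2) * ‖x‖ ^ 2) : ℝ) : ℂ) := by push_cast; rfl
      rw [this, Complex.ofReal_re]
    rw [hGdef, ← ofReal_integral_eq_lintegral_ofReal (hi.const_mul _)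
      (Filter.Eventually.of_forall fun z => by positivity), integral_const_mul,
      GaussianFourier.integral_rexp_neg_mul_sq_norm hb2]
    congr 1
    simp only [finrank_euclideanSpace, Fintype.card_fin]
    norm_num
    field_simp
  rw [← hG]
  calc _ ≤ ∫⁻ p : Sp × Sp, ‖((Real.pi / b) ^ 2 *
      Real.exp (-(Real.pi ^ 2 / b) * ‖ψ p.1 - ψ p.2‖ ^ 2) : ℝ) *
        (H p.1 * (starRingEnd ℂ) (H p.2))‖ₑ := enorm_integral_le_lintegral_enorm _
    _ ≤ ∫⁻ p : Sp × Sp, G (p.1 - p.2) * (‖H p.1‖ₑ * ‖H p.2‖ₑ) := by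
        gcongr with p
        rw [enorm_mul, enorm_mul, RCLike.enorm_conj]
        by_cases h1 : H p.1 = 0
        · simp [h1]
        by_cases h2 : H p.2 = 0
        · simp [h2]
        gcongr
        rw [← ofReal_norm, Complex.norm_of_nonneg (by positivity), hGdef]
        have h3 := hexp _ _ h1 h2
        apply ENNReal.ofReal_le_ofReal
        gcongr ?_ * Real.exp ?_
        have h4 : c ^ 2 * ‖p.1 - p.2‖ ^ 2 ≤ ‖ψ p.1 - ψ p.2‖ ^ 2 := by
          rw [← mul_pow]; gcongr
        have h5 : 0 ≤ Real.pi ^ 2 / b := by positivity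
        nlinarith
    _ ≤ _ := by
        apply lintegral_conv_kernel_le
        · fun_prop
        · fun_prop

lemma measurable_oscExt {ψ : Sp → Sp} {H : Sp → ℂ} (hψ : Measurable ψ) (hHm : Measurable H) :
    Measurable (oscExt ψ H) := by
  apply StronglyMeasurable.measurable
  unfold oscExt
  apply StronglyMeasurable.integral_prod_right
  apply Measurable.stronglyMeasurable
  fun_prop

/-- An `L²` extension estimate for phases that do not contract distances. -/
theorem lintegral_oscExt_sq_le {ψ : Sp → Sp} {H : Sp → ℂ} (hψ : Measurable ψ)
    (hHm : Measurable H) (hH : Integrable H) {c : ℝ} (hc : 0 < c)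
    (hexp : ∀ ξ η, H ξ ≠ 0 → H η ≠ 0 → c * ‖ξ - η‖ ≤ ‖ψ ξ - ψ η‖) :
    ∫⁻ z, ‖oscExt ψ H z‖ₑ ^ 2 ≤ 2 * ENNReal.ofReal (c⁻¹ ^ 4) * ∫⁻ ξ, ‖H ξ‖ₑ ^ 2 := by
  have hm := measurable_oscExt hψ hHm
  set b : ℕ → ℝ := fun n => 1 / ((n : ℝ) + 1) with hbdef
  have hb : ∀ n, 0 < b n := fun n => by simp only [hbdef]; positivity
  set F : ℕ → Sp → ℝ≥0∞ := fun n z =>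
    ENNReal.ofReal (Real.exp (-b n * ‖z‖ ^ 2)) * ‖oscExt ψ H z‖ₑ ^ 2 with hF
  have hlim : ∀ z, Filter.Tendsto (fun n => F n z) Filter.atTop (nhds (‖oscExt ψ H z‖ₑ ^ 2)) := by
    intro z
    have h1 : Filter.Tendsto b Filter.atTop (nhds 0) := tendsto_one_div_add_atTop_nhds_zero_nat
    have h2 : Filter.Tendsto (fun n => Real.exp (-b n * ‖z‖ ^ 2)) Filter.atTop (nhds 1) := by
      have : Filter.Tendsto (fun n => Real.exp (-b n * ‖z‖ ^ 2)) Filter.atTop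
          (nhds (Real.exp (-0 * ‖z‖ ^ 2))) :=
        (Real.continuous_exp.tendsto _).comp ((h1.neg).mul_const _)
      simpa using this
    have h3 := ENNReal.tendsto_ofReal h2
    have h4 := ENNReal.Tendsto.mul_const (b := ‖oscExt ψ H z‖ₑ ^ 2) h3 (by simp)
    simpa [hF] using h4
  calc ∫⁻ z, ‖oscExt ψ H z‖ₑ ^ 2 = ∫⁻ z, Filter.liminf (fun n => F n z) Filter.atTop := by
        congr 1; ext z; exact (hlim z).liminf_eq.symm
    _ ≤ Filter.liminf (fun n => ∫⁻ z, F n z) Filter.atTop :=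
        lintegral_liminf_le fun n => by simp only [hF]; fun_prop
    _ ≤ _ := by
        refine Filter.liminf_le_of_le (by isBoundedDefault) fun x hx => ?_
        obtain ⟨n, hn⟩ := hx.exists
        exact hn.trans (gaussian_oscExt_le hψ hHm hH hc hexp (hb n))

/-- The point with `i`-th coordinate `s` and remaining coordinates `y`. -/
def ins (i : Fin 4) (s : ℝ) (y : Fin 3 → ℝ) : Sp := WithLp.toLp 2 (i.insertNth s y)

@[simp] lemma ins_same (i : Fin 4) (s : ℝ) (y : Fin 3 → ℝ) : ins i s y i = s := by
  simp [ins]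

@[simp] lemma ins_succAbove (i : Fin 4) (s : ℝ) (y : Fin 3 → ℝ) (j : Fin 3) :
    ins i s y (i.succAbove j) = y j := by
  simp [ins]

lemma continuous_ins (i : Fin 4) : Continuous fun p : ℝ × (Fin 3 → ℝ) => ins i p.1 p.2 := by
  unfold ins
  exact (PiLp.continuous_toLp 2 _).comp (Continuous.finInsertNth i continuous_fst continuous_snd)

lemma inner_ins (i : Fin 4) (s : ℝ) (y : Fin 3 → ℝ) (ξ : Sp) :
    ⟪ins i s y, ξ⟫ = s * ξ i + ∑ j, y j * ξ (i.succAbove j) := by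
  rw [PiLp.inner_apply, Fin.sum_univ_succAbove _ i]
  simp [mul_comm]

lemma norm_ins_sq (i : Fin 4) (s : ℝ) (y : Fin 3 → ℝ) :
    ‖ins i s y‖ ^ 2 = s ^ 2 + ∑ j, y j ^ 2 := by
  rw [EuclideanSpace.norm_sq_eq, Fin.sum_univ_succAbove _ i]
  simp

lemma norm_sq_succAbove (i : Fin 4) (ξ : Sp) :
    ‖ξ‖ ^ 2 = ξ i ^ 2 + ∑ j, ξ (i.succAbove j) ^ 2 := by
  rw [EuclideanSpace.norm_sq_eq, Fin.sum_univ_succAbove _ i]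
  simp

lemma lintegral_ins (i : Fin 4) {g : Sp → ℝ≥0∞} (hg : Measurable g) :
    ∫⁻ x, g x = ∫⁻ s, ∫⁻ y, g (ins i s y) := by
  have h1 := (PiLp.volume_preserving_toLp (Fin 4)).lintegral_comp hg
  have h2 := ((volume_preserving_piFinSuccAbove (fun _ : Fin 4 => ℝ) i).symm).lintegral_comp
    (f := fun z : Fin 4 → ℝ => g (WithLp.toLp 2 z)) (hg.comp (by fun_prop))
  rw [← h1, ← h2, Measure.volume_eq_prod, lintegral_prod]
  · rfl
  · exact (hg.comp (continuous_ins i).measurable).aemeasurable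

/-- The half-wave integral with frequency profile `h`. -/
def hw (h : Sp → ℂ) (t : ℝ) (x : Sp) : ℂ :=
  ∫ ξ : Sp, cexp (2 * Real.pi * I * ((t * ‖ξ‖ + ⟪x, ξ⟫ : ℝ) : ℂ)) * h ξ

/-- Replace the `i`-th coordinate by the norm. -/
def coneMap (i : Fin 4) (ξ : Sp) : Sp := ins i ‖ξ‖ (fun j => ξ (i.succAbove j))

lemma continuous_coneMap (i : Fin 4) : Continuous (coneMap i) := by
  unfold coneMap
  exact (continuous_ins i).comp (f := fun ξ : Sp => (‖ξ‖, fun j => ξ (i.succAbove j)))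
    (by fun_prop)

lemma hw_ins (i : Fin 4) (h : Sp → ℂ) (t s : ℝ) (y : Fin 3 → ℝ) :
    hw h t (ins i s y) =
      oscExt (coneMap i) (fun ξ => cexp (2 * Real.pi * I * ((s * ξ i : ℝ) : ℂ)) * h ξ)
        (ins i t y) := by
  unfold hw oscExt
  congr 1
  ext ξ
  rw [← mul_assoc, ← Complex.exp_add, ← mul_add, ← Complex.ofReal_add]
  congr 4
  rw [inner_ins, inner_ins]
  simp only [coneMap, ins_same, ins_succAbove]
  ring

lemma cone_coordinate_diff_sq_le {a b A B P Q D : ℝ} (hA : 0 ≤ A) (hB : 0 ≤ B) (hP : 0 ≤ P)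
    (hQ : 0 ≤ Q) (hDn : 0 ≤ D) (hξ : A ≤ 2 * a) (hη : B ≤ 2 * b) (e3 : A ^ 2 = a ^ 2 + P ^ 2)
    (e4 : B ^ 2 = b ^ 2 + Q ^ 2) (hD : |P - Q| ≤ D) :
    (a - b) ^ 2 ≤ 8 * ((A - B) ^ 2 + D ^ 2) := by
  have hPA : P ≤ A := abs_le_of_sq_le_sq' (by nlinarith [sq_nonneg a]) hA |>.2
  have hQB : Q ≤ B := abs_le_of_sq_le_sq' (by nlinarith [sq_nonneg b]) hB |>.2
  have h1 : (a - b) * (a + b) = (A - B) * (A + B) - (P - Q) * (P + Q) := by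
    linear_combination e4 - e3
  have h2 : |a - b| * ((A + B) / 2) ≤ (|A - B| + D) * (A + B) := by
    calc |a - b| * ((A + B) / 2) ≤ |a - b| * (a + b) := by
          gcongr; linarith
      _ = |(a - b) * (a + b)| := by
          rw [abs_mul, abs_of_nonneg (show 0 ≤ a + b by linarith)]
      _ = |(A - B) * (A + B) - (P - Q) * (P + Q)| := by rw [h1]
      _ ≤ |(A - B) * (A + B)| + |(P - Q) * (P + Q)| := abs_sub _ _
      _ = |A - B| * (A + B) + |P - Q| * (P + Q) := by
          rw [abs_mul, abs_mul, abs_of_nonneg (show 0 ≤ A + B by linarith),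
            abs_of_nonneg (show 0 ≤ P + Q by linarith)]
      _ ≤ |A - B| * (A + B) + D * (A + B) := by gcongr
      _ = _ := by ring
  rcases eq_or_lt_of_le (show 0 ≤ A + B by linarith) with h0 | h0
  · have hA0 : A = 0 := by linarith
    have hB0 : B = 0 := by linarith
    have ha0 : a = 0 := by
      rw [hA0] at e3
      exact pow_eq_zero_iff two_ne_zero |>.1 (by nlinarith [sq_nonneg P, sq_nonneg a])
    have hb0 : b = 0 := by
      rw [hB0] at e4
      exact pow_eq_zero_iff two_ne_zero |>.1 (by nlinarith [sq_nonneg Q, sq_nonneg b])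
    rw [ha0, hb0]
    nlinarith [sq_nonneg (A - B), sq_nonneg D]
  · have h3 : |a - b| ≤ 2 * (|A - B| + D) := by
      have : |a - b| * (A + B) ≤ (2 * (|A - B| + D)) * (A + B) := by linarith
      exact le_of_mul_le_mul_right this h0
    have h4 : (a - b) ^ 2 ≤ (2 * (|A - B| + D)) ^ 2 := by
      rw [← sq_abs (a - b)]; gcongr
    nlinarith [sq_abs (A - B), sq_nonneg (|A - B| - D)]

lemma coneMap_expansion (i : Fin 4) {σ : ℝ} (hσ : σ ^ 2 = 1) (ξ η : Sp)
    (hξ : ‖ξ‖ ≤ 2 * (σ * ξ i)) (hη : ‖η‖ ≤ 2 * (σ * η i)) :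
    (1 / 3 : ℝ) * ‖ξ - η‖ ≤ ‖coneMap i ξ - coneMap i η‖ := by
  have e1 := norm_sq_succAbove i (ξ - η)
  have e2 := norm_sq_succAbove i (coneMap i ξ - coneMap i η)
  have e3 := norm_sq_succAbove i ξ
  have e4 := norm_sq_succAbove i η
  simp only [coneMap, PiLp.sub_apply, ins_same, ins_succAbove] at e1 e2
  set A := ‖ξ‖
  set B := ‖η‖
  set p : EuclideanSpace ℝ (Fin 3) := WithLp.toLp 2 fun j => ξ (i.succAbove j)
  set q : EuclideanSpace ℝ (Fin 3) := WithLp.toLp 2 fun j => η (i.succAbove j)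
  have hp : ∑ j, ξ (i.succAbove j) ^ 2 = ‖p‖ ^ 2 := by
    rw [EuclideanSpace.norm_sq_eq]; simp [p]
  have hq : ∑ j, η (i.succAbove j) ^ 2 = ‖q‖ ^ 2 := by
    rw [EuclideanSpace.norm_sq_eq]; simp [q]
  have hpq : ∑ j, (ξ (i.succAbove j) - η (i.succAbove j)) ^ 2 = ‖p - q‖ ^ 2 := by
    rw [EuclideanSpace.norm_sq_eq]; simp [p, q]
  rw [hpq] at e1 e2
  rw [hp] at e3
  rw [hq] at e4
  have hD : |‖p‖ - ‖q‖| ≤ ‖p - q‖ := abs_norm_sub_norm_le p q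
  have hA : 0 ≤ A := norm_nonneg _
  have hB : 0 ≤ B := norm_nonneg _
  have hP : 0 ≤ ‖p‖ := norm_nonneg _
  have hQ : 0 ≤ ‖q‖ := norm_nonneg _
  have hDn : 0 ≤ ‖p - q‖ := norm_nonneg _
  set D := ‖p - q‖
  set P := ‖p‖
  set Q := ‖q‖
  obtain ⟨a, ha⟩ : ∃ a, a = σ * ξ i := ⟨_, rfl⟩
  obtain ⟨b, hb⟩ : ∃ b, b = σ * η i := ⟨_, rfl⟩
  rw [← ha] at hξ
  rw [← hb] at hη
  have ha2 : ξ i ^ 2 = a ^ 2 := by rw [ha]; linear_combination (-(ξ i) ^ 2) * hσ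
  have hb2 : η i ^ 2 = b ^ 2 := by rw [hb]; linear_combination (-(η i) ^ 2) * hσ
  have hab : (ξ i - η i) ^ 2 = (a - b) ^ 2 := by
    rw [ha, hb]; linear_combination (-(ξ i - η i) ^ 2) * hσ
  rw [hab] at e1
  rw [ha2] at e3
  rw [hb2] at e4
  have key := cone_coordinate_diff_sq_le hA hB hP hQ hDn hξ hη e3 e4 hD
  refine le_of_sq_le_sq ?_ (norm_nonneg _)
  unfold coneMap
  rw [mul_pow, e1, e2]
  nlinarith [sq_nonneg (A - B), sq_nonneg D]

lemma measurable_hw {h : Sp → ℂ} (hm : Measurable h) :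
    Measurable fun p : ℝ × Sp => hw h p.1 p.2 := by
  unfold hw
  have : StronglyMeasurable (fun q : (ℝ × Sp) × Sp =>
      cexp (2 * Real.pi * I * ((q.1.1 * ‖q.2‖ + ⟪q.1.2, q.2⟫ : ℝ) : ℂ)) * h q.2) := by
    apply StronglyMeasurable.mul
    · apply Continuous.stronglyMeasurable
      fun_prop
    · exact (hm.comp measurable_snd).stronglyMeasurable
  exact this.integral_prod_right.measurable

lemma lintegral_slab_le (i : Fin 4) {σ : ℝ} (hσ : σ ^ 2 = 1) {h : Sp → ℂ} (hm : Measurable h)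
    (hi : Integrable h) (hs : ∀ ξ, h ξ ≠ 0 → ‖ξ‖ ≤ 2 * (σ * ξ i)) (s : ℝ) :
    ∫⁻ t, ∫⁻ y, ‖hw h t (ins i s y)‖ₑ ^ 2 ≤
      2 * ENNReal.ofReal ((1 / 3 : ℝ)⁻¹ ^ 4) * ∫⁻ ξ, ‖h ξ‖ₑ ^ 2 := by
  set H : Sp → ℂ := fun ξ => cexp (2 * Real.pi * I * ((s * ξ i : ℝ) : ℂ)) * h ξ with hH
  have hc : Continuous fun ξ : Sp => cexp (2 * Real.pi * I * ((s * ξ i : ℝ) : ℂ)) := by fun_prop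
  have hHm : Measurable H := hc.measurable.mul hm
  have hne : ∀ ξ, ‖H ξ‖ = ‖h ξ‖ := fun ξ => by
    rw [hH]; simp only [norm_mul, norm_cexp_two_pi_I, one_mul]
  have hHi : Integrable H := hi.congr' hHm.aestronglyMeasurable (.of_forall fun ξ => (hne ξ).symm)
  have h1 := lintegral_oscExt_sq_le (continuous_coneMap i).measurable hHm hHi
    (show (0 : ℝ) < 1 / 3 by norm_num) (fun ξ η h1 h2 =>
      coneMap_expansion i hσ ξ η (hs ξ (right_ne_zero_of_mul h1)) (hs η (right_ne_zero_of_mul h2)))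
  rw [lintegral_ins i ((measurable_oscExt (continuous_coneMap i).measurable hHm).enorm.pow_const 2)]
    at h1
  simp only [hw_ins]
  convert h1 using 4 with ξ
  rw [← ofReal_norm, ← ofReal_norm, hne]

lemma lintegral_one_add_mul_abs_rpow {β : ℝ} (hβ : 1 < β) {μ : ℝ} (hμ : 0 < μ) :
    ∫⁻ s : ℝ, ENNReal.ofReal ((1 + μ * |s|) ^ (-β)) =
      ENNReal.ofReal μ⁻¹ * ENNReal.ofReal (∫ s : ℝ, (1 + ‖s‖) ^ (-β)) := by
  have hi : Integrable fun s : ℝ => (1 + ‖s‖) ^ (-β) :=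
    integrable_one_add_norm (by simpa using hβ)
  have hi2 : Integrable fun s : ℝ => (1 + ‖μ * s‖) ^ (-β) := hi.comp_mul_left' hμ.ne'
  have h2 := Measure.integral_comp_mul_left (fun s : ℝ => (1 + ‖s‖) ^ (-β)) μ
  rw [← ENNReal.ofReal_mul (by positivity)]
  have h3 : ∫ s : ℝ, (1 + ‖μ * s‖) ^ (-β) = μ⁻¹ * ∫ s : ℝ, (1 + ‖s‖) ^ (-β) := by
    rw [h2, abs_of_pos (by positivity), smul_eq_mul]
  rw [← h3, ofReal_integral_eq_lintegral_ofReal hi2 (.of_forall fun s => by positivity)]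
  simp [abs_of_pos hμ]

lemma abs_coord_le_norm (x : Sp) (i : Fin 4) : |x i| ≤ ‖x‖ := by
  simpa using PiLp.norm_apply_le x i

lemma weighted_sector_le {β : ℝ} (hβ : 1 < β) (i : Fin 4) {σ : ℝ} (hσ : σ ^ 2 = 1) {h : Sp → ℂ}
    (hm : Measurable h) (hi : Integrable h) (hs : ∀ ξ, h ξ ≠ 0 → ‖ξ‖ ≤ 2 * (σ * ξ i))
    {μ : ℝ} (hμ : 0 < μ) :
    ∫⁻ t, ∫⁻ x, ENNReal.ofReal ((1 + μ * ‖x‖) ^ (-β)) * ‖hw h t x‖ₑ ^ 2 ≤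
      ENNReal.ofReal μ⁻¹ * ENNReal.ofReal (∫ s : ℝ, (1 + ‖s‖) ^ (-β)) *
        (2 * ENNReal.ofReal ((1 / 3 : ℝ)⁻¹ ^ 4) * ∫⁻ ξ, ‖h ξ‖ₑ ^ 2) := by
  have hmw := measurable_hw hm
  have hW : Measurable fun s : ℝ => ENNReal.ofReal ((1 + μ * |s|) ^ (-β)) := by fun_prop
  calc _ ≤ ∫⁻ t, ∫⁻ x : Sp, ENNReal.ofReal ((1 + μ * |x i|) ^ (-β)) * ‖hw h t x‖ₑ ^ 2 := by
        refine lintegral_mono fun t => lintegral_mono fun x =>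
          mul_le_mul_left (ENNReal.ofReal_le_ofReal ?_) _
        have h0 : 0 < 1 + μ * |x i| := by positivity
        refine Real.rpow_le_rpow_of_nonpos h0 ?_ (by linarith)
        gcongr
        exact abs_coord_le_norm x i
    _ = ∫⁻ t, ∫⁻ s, ENNReal.ofReal ((1 + μ * |s|) ^ (-β)) * ∫⁻ y, ‖hw h t (ins i s y)‖ₑ ^ 2 := by
        congr with t
        rw [lintegral_ins i]
        · congr with s
          simp only [ins_same]
          rw [lintegral_const_mul' _ _ ENNReal.ofReal_ne_top]
        · have : Measurable fun x => hw h t x := hmw.comp (measurable_const.prodMk measurable_id)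
          exact (hW.comp (by fun_prop)).mul (this.enorm.pow_const 2)
    _ = ∫⁻ s, ENNReal.ofReal ((1 + μ * |s|) ^ (-β)) * ∫⁻ t, ∫⁻ y, ‖hw h t (ins i s y)‖ₑ ^ 2 := by
        rw [lintegral_lintegral_swap]
        · congr with s
          rw [lintegral_const_mul' _ _ ENNReal.ofReal_ne_top]
        · have h1 : Measurable fun q : (ℝ × ℝ) × (Fin 3 → ℝ) =>
              ‖hw h q.1.1 (ins i q.1.2 q.2)‖ₑ ^ 2 :=
            (hmw.comp ((measurable_fst.comp measurable_fst).prodMk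
              ((continuous_ins i).measurable.comp
                ((measurable_snd.comp measurable_fst).prodMk measurable_snd)))).enorm.pow_const 2
          exact ((hW.comp measurable_snd).mul h1.lintegral_prod_right').aemeasurable
    _ ≤ ∫⁻ s, ENNReal.ofReal ((1 + μ * |s|) ^ (-β)) *
        (2 * ENNReal.ofReal ((1 / 3 : ℝ)⁻¹ ^ 4) * ∫⁻ ξ, ‖h ξ‖ₑ ^ 2) := by
        gcongr with s
        exact lintegral_slab_le i hσ hm hi hs s
    _ = _ := by
        rw [lintegral_mul_const _ hW, lintegral_one_add_mul_abs_rpow hβ hμ]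

/-- The sign attached to a Boolean. -/
def bsign (b : Bool) : ℝ := if b then 1 else -1

lemma bsign_sq (b : Bool) : bsign b ^ 2 = 1 := by cases b <;> simp [bsign]

/-- The eight closed sectors around the coordinate half-axes. -/
def sector (k : Fin 4 × Bool) : Set Sp := {x | ‖x‖ ≤ 2 * (bsign k.2 * x k.1)}

lemma isClosed_sector (k : Fin 4 × Bool) : IsClosed (sector k) :=
  isClosed_le (by fun_prop) (by fun_prop)

lemma exists_mem_sector (x : Sp) : ∃ k, x ∈ sector k := by
  obtain ⟨i, hi⟩ : ∃ i : Fin 4, ‖x‖ ^ 2 ≤ 4 * x i ^ 2 := by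
    by_contra! hcon
    have := EuclideanSpace.real_norm_sq_eq x
    rw [Fin.sum_univ_four] at this
    linarith [hcon 0, hcon 1, hcon 2, hcon 3]
  have h2 : ‖x‖ ≤ 2 * |x i| := by
    refine le_of_sq_le_sq ?_ (by positivity)
    rw [mul_pow, sq_abs]; linarith
  rcases abs_cases (x i) with ⟨h, _⟩ | ⟨h, _⟩
  · exact ⟨(i, true), by simpa [sector, bsign, h] using h2⟩
  · exact ⟨(i, false), by simpa [sector, bsign, h] using h2⟩

/-- The number of sectors containing a point. -/
def sectorCount (x : Sp) : ℝ := ∑ k, (sector k).indicator (fun _ => (1 : ℝ)) x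

lemma one_le_sectorCount (x : Sp) : 1 ≤ sectorCount x := by
  obtain ⟨k, hk⟩ := exists_mem_sector x
  have := Finset.single_le_sum (f := fun k => (sector k).indicator (fun _ => (1 : ℝ)) x)
    (fun k _ => Set.indicator_nonneg (fun _ _ => zero_le_one) x) (Finset.mem_univ k)
  rw [Set.indicator_of_mem hk] at this
  exact this

lemma measurable_sectorCount : Measurable sectorCount := by
  unfold sectorCount
  exact Finset.measurable_sum _ fun k _ =>
    measurable_const.indicator (isClosed_sector k).measurableSet

lemma exists_sector_decomposition {h : Sp → ℂ} (hm : Measurable h) :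
    ∃ g : Fin 4 × Bool → Sp → ℂ, (∀ k, Measurable (g k)) ∧ (∀ k ξ, ‖g k ξ‖ ≤ ‖h ξ‖) ∧
      (∀ k ξ, g k ξ ≠ 0 → ξ ∈ sector k) ∧ ∀ ξ, h ξ = ∑ k, g k ξ := by
  set g : Fin 4 × Bool → Sp → ℂ := fun k =>
    (sector k).indicator fun ξ => ((sectorCount ξ)⁻¹ : ℝ) * h ξ with hg
  have hgm : ∀ k, Measurable (g k) := fun k =>
    ((Complex.measurable_ofReal.comp measurable_sectorCount.inv).mul hm).indicator
      (isClosed_sector k).measurableSet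
  have hgle : ∀ k ξ, ‖g k ξ‖ ≤ ‖h ξ‖ := fun k ξ => by
    refine (norm_indicator_le_norm_self _ _).trans ?_
    rw [norm_mul, Complex.norm_real, Real.norm_eq_abs]
    have h1 := one_le_sectorCount ξ
    rw [abs_of_nonneg (by positivity)]
    exact mul_le_of_le_one_left (norm_nonneg _) (inv_le_one_of_one_le₀ h1)
  have hsum : ∀ ξ, h ξ = ∑ k, g k ξ := fun ξ => by
    have h1 : ∀ k, g k ξ =
        (((sector k).indicator (fun _ => (1 : ℝ)) ξ : ℝ) : ℂ) *
          (((sectorCount ξ)⁻¹ : ℝ) * h ξ) := by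
      intro k
      by_cases hk : ξ ∈ sector k <;> simp [hg, hk]
    simp_rw [h1]
    rw [← Finset.sum_mul, ← Complex.ofReal_sum, ← mul_assoc, ← Complex.ofReal_mul]
    have h2 : sectorCount ξ ≠ 0 := (zero_lt_one.trans_le (one_le_sectorCount ξ)).ne'
    change h ξ = ((sectorCount ξ * (sectorCount ξ)⁻¹ : ℝ) : ℂ) * h ξ
    rw [mul_inv_cancel₀ h2]; simp
  exact ⟨g, hgm, hgle, fun k ξ hξ => Set.mem_of_indicator_ne_zero hξ, hsum⟩

lemma enorm_sum_sq_le {ι : Type*} [Fintype ι] (z : ι → ℂ) :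
    ‖∑ k, z k‖ₑ ^ 2 ≤ Fintype.card ι * ∑ k, ‖z k‖ₑ ^ 2 := by
  have h1 : ‖∑ k, z k‖₊ ^ 2 ≤ Fintype.card ι * ∑ k, ‖z k‖₊ ^ 2 := by
    calc _ ≤ (∑ k, ‖z k‖₊) ^ 2 := by gcongr; exact nnnorm_sum_le _ _
      _ ≤ _ := by
        simpa using sq_sum_le_card_mul_sum_sq (s := (Finset.univ : Finset ι))
          (f := fun k => ‖z k‖₊)
  simp only [enorm_eq_nnnorm]
  exact_mod_cast h1

lemma lintegral_lintegral_sum_const_mul {ι : Type*} [Fintype ι] {c : ℝ≥0∞} (hc : c ≠ ∞)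
    (F : ι → ℝ → Sp → ℝ≥0∞) (hF : ∀ k, Measurable fun p : ℝ × Sp => F k p.1 p.2) :
    ∫⁻ t, ∫⁻ x, ∑ k, c * F k t x = ∑ k, c * ∫⁻ t, ∫⁻ x, F k t x := by
  have hmm : ∀ k, Measurable fun p : ℝ × Sp => c * F k p.1 p.2 := fun k => (hF k).const_mul c
  have h1 : ∀ t, ∫⁻ x, ∑ k, c * F k t x = ∑ k, ∫⁻ x, c * F k t x :=
    fun t => lintegral_finsetSum _ fun k _ => (hmm k).comp (measurable_const.prodMk measurable_id)
  simp_rw [h1]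
  rw [lintegral_finsetSum _ fun k _ => (hmm k).lintegral_prod_right']
  congr with k
  simp_rw [lintegral_const_mul' c _ hc]

lemma weighted_energy_le {β : ℝ} (hβ : 1 < β) {h : Sp → ℂ}
    (hm : Measurable h) (hi : Integrable h) {μ : ℝ} (hμ : 0 < μ) :
    ∫⁻ t, ∫⁻ x, ENNReal.ofReal ((1 + μ * ‖x‖) ^ (-β)) * ‖hw h t x‖ₑ ^ 2 ≤
      64 * (ENNReal.ofReal μ⁻¹ * ENNReal.ofReal (∫ s : ℝ, (1 + ‖s‖) ^ (-β)) *
        (2 * ENNReal.ofReal ((1 / 3 : ℝ)⁻¹ ^ 4) * ∫⁻ ξ, ‖h ξ‖ₑ ^ 2)) := by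
  obtain ⟨g, hgm, hgle, hgs, hsum⟩ := exists_sector_decomposition hm
  have hgi : ∀ k, Integrable (g k) := fun k =>
    hi.mono (hgm k).aestronglyMeasurable (.of_forall (hgle k))
  have hhw : ∀ t x, hw h t x = ∑ k, hw (g k) t x := fun t x => by
    unfold hw
    rw [← integral_finsetSum]
    · congr with ξ
      rw [← Finset.mul_sum, ← hsum]
    · intro k _
      have hc : Continuous fun ξ : Sp =>
        cexp (2 * Real.pi * I * ((t * ‖ξ‖ + ⟪x, ξ⟫ : ℝ) : ℂ)) := by fun_prop
      refine (hgi k).congr' (hc.measurable.mul (hgm k)).aestronglyMeasurable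
        (.of_forall fun ξ => ?_)
      simp only [norm_mul, norm_cexp_two_pi_I, one_mul]
  have hsq : ∀ t x, ‖hw h t x‖ₑ ^ 2 ≤ 8 * ∑ k, ‖hw (g k) t x‖ₑ ^ 2 := fun t x => by
    rw [hhw]
    exact (enorm_sum_sq_le _).trans_eq (by simp)
  have hWm : Measurable fun x : Sp => ENNReal.ofReal ((1 + μ * ‖x‖) ^ (-β)) := by fun_prop
  calc _ ≤ ∫⁻ t, ∫⁻ x, ∑ k, 8 * (ENNReal.ofReal ((1 + μ * ‖x‖) ^ (-β)) * ‖hw (g k) t x‖ₑ ^ 2) := by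
        gcongr with t x
        rw [← Finset.mul_sum, ← Finset.mul_sum, mul_left_comm]
        gcongr
        exact hsq t x
    _ = ∑ k, 8 * ∫⁻ t, ∫⁻ x, ENNReal.ofReal ((1 + μ * ‖x‖) ^ (-β)) * ‖hw (g k) t x‖ₑ ^ 2 :=
        lintegral_lintegral_sum_const_mul (by norm_num)
          (fun k t x => ENNReal.ofReal ((1 + μ * ‖x‖) ^ (-β)) * ‖hw (g k) t x‖ₑ ^ 2)
          fun k => (hWm.comp measurable_snd).mul ((measurable_hw (hgm k)).enorm.pow_const 2)
    _ ≤ ∑ _k : Fin 4 × Bool, 8 * (ENNReal.ofReal μ⁻¹ * ENNReal.ofReal (∫ s : ℝ, (1 + ‖s‖) ^ (-β)) *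
        (2 * ENNReal.ofReal ((1 / 3 : ℝ)⁻¹ ^ 4) * ∫⁻ ξ, ‖h ξ‖ₑ ^ 2)) := by
        gcongr with k
        refine (weighted_sector_le hβ k.1 (bsign_sq k.2) (hgm k) (hgi k)
          (fun ξ hξ => ?_) hμ).trans ?_
        · exact hgs k ξ hξ
        · gcongr with ξ
          exact enorm_le_iff_norm_le.2 (hgle k ξ)
    _ = _ := by
        rw [Finset.sum_const, nsmul_eq_mul, ← mul_assoc]
        congr 1
        simp only [Finset.card_univ, Fintype.card_prod, Fintype.card_fin, Fintype.card_bool]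
        norm_num

/-- The angular momentum operators on Schwartz functions. -/
def schwartzOmega (i j : Fin 4) (f : SchwartzMap Sp ℂ) : SchwartzMap Sp ℂ :=
  SchwartzMap.smulLeftCLM ℂ (fun x : Sp => (inner ℝ x (EuclideanSpace.single i (1 : ℝ)) : ℝ))
      (LineDeriv.lineDerivOp (EuclideanSpace.single j (1 : ℝ)) f)
    - SchwartzMap.smulLeftCLM ℂ (fun x : Sp => (inner ℝ x (EuclideanSpace.single j (1 : ℝ)) : ℝ))
      (LineDeriv.lineDerivOp (EuclideanSpace.single i (1 : ℝ)) f)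

lemma hasTemperateGrowth_inner_left (m : Sp) :
    (fun x : Sp => (inner ℝ x m : ℝ)).HasTemperateGrowth := by fun_prop

lemma schwartzOmega_apply (i j : Fin 4) (f : SchwartzMap Sp ℂ) (x : Sp) :
    schwartzOmega i j f x = Omega i j f x := by
  unfold schwartzOmega Omega
  rw [_root_.sub_apply, SchwartzMap.smulLeftCLM_apply_apply (hasTemperateGrowth_inner_left _),
    SchwartzMap.smulLeftCLM_apply_apply (hasTemperateGrowth_inner_left _)]
  simp [SchwartzMap.lineDerivOp_apply_eq_fderiv, EuclideanSpace.inner_single_right]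

lemma lineDerivOp_smulLeftCLM_apply (m n : Sp) (f : SchwartzMap Sp ℂ) (x : Sp) :
    (LineDeriv.lineDerivOp n (SchwartzMap.smulLeftCLM ℂ (fun x : Sp => (inner ℝ x m : ℝ)) f) :
      SchwartzMap Sp ℂ) x =
      (inner ℝ n m : ℝ) • f x + (inner ℝ x m : ℝ) • fderiv ℝ f x n := by
  rw [SchwartzMap.lineDerivOp_apply_eq_fderiv,
    SchwartzMap.smulLeftCLM_apply (hasTemperateGrowth_inner_left _)]
  have h1 : HasFDerivAt (fun x : Sp => (inner ℝ x m : ℝ)) ((innerSL ℝ).flip m) x :=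
    ((innerSL ℝ).flip m).hasFDerivAt
  have h2 := (f.differentiableAt (x := x)).hasFDerivAt
  rw [(h1.fun_smul h2).fderiv]
  have h3 : ((innerSL ℝ).flip m) n = (inner ℝ n m : ℝ) := rfl
  simp only [_root_.add_apply, _root_.smul_apply, ContinuousLinearMap.smulRight_apply,
    h3]
  rw [add_comm]

lemma fourierInv_schwartzOmega (i j : Fin 4) (k : SchwartzMap Sp ℂ) :
    𝓕⁻ (schwartzOmega i j k) = schwartzOmega i j (𝓕⁻ k) := by
  have key : ∀ m n : Sp, 𝓕⁻ (SchwartzMap.smulLeftCLM ℂ (fun x : Sp => (inner ℝ x m : ℝ))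
      (LineDeriv.lineDerivOp n k : SchwartzMap Sp ℂ)) = -(LineDeriv.lineDerivOp m
        (SchwartzMap.smulLeftCLM ℂ (fun x : Sp => (inner ℝ x n : ℝ)) (𝓕⁻ k)) :
          SchwartzMap Sp ℂ) := by
    intro m n
    have h1 := SchwartzMap.lineDerivOp_fourierInv_eq
      (LineDeriv.lineDerivOp n k : SchwartzMap Sp ℂ) m
    rw [SchwartzMap.fourierInv_lineDerivOp_eq, FourierTransform.fourierInv_smul] at h1
    have hc : (2 * Real.pi * I : ℂ) ≠ 0 := Complex.two_pi_I_ne_zero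
    rw [neg_smul, LineDeriv.lineDerivOp_neg, LineDeriv.lineDerivOp_smul, ← smul_neg] at h1
    exact (smul_right_injective _ hc h1).symm
  unfold schwartzOmega
  have hsub : ∀ a b : SchwartzMap Sp ℂ, 𝓕⁻ (a - b) = 𝓕⁻ a - 𝓕⁻ b :=
    map_sub (FourierTransform.fourierInvCLM ℂ (SchwartzMap Sp ℂ))
  rw [hsub, key, key]
  ext x
  simp only [_root_.sub_apply, _root_.neg_apply, lineDerivOp_smulLeftCLM_apply]
  rw [SchwartzMap.smulLeftCLM_apply_apply (hasTemperateGrowth_inner_left _),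
    SchwartzMap.smulLeftCLM_apply_apply (hasTemperateGrowth_inner_left _)]
  rw [real_inner_comm]
  simp [SchwartzMap.lineDerivOp_apply_eq_fderiv]
  ring

lemma fourier_schwartzOmega (i j : Fin 4) (f : SchwartzMap Sp ℂ) :
    𝓕 (schwartzOmega i j f) = schwartzOmega i j (𝓕 f) := by
  have h := fourierInv_schwartzOmega i j (𝓕 f)
  rw [FourierTransform.fourierInv_fourier_eq] at h
  rw [← h, FourierTransform.fourier_fourierInv_eq]

lemma lintegral_enorm_sq_fourier (f : SchwartzMap Sp ℂ) :
    ∫⁻ ξ, ‖(𝓕 f : SchwartzMap Sp ℂ) ξ‖ₑ ^ 2 = eLpNorm f 2 volume ^ 2 := by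
  have h1 := SchwartzMap.norm_fourier_toL2_eq f
  rw [SchwartzMap.norm_toLp, SchwartzMap.norm_toLp] at h1
  have e1 : eLpNorm (⇑(𝓕 f : SchwartzMap Sp ℂ)) 2 volume ≠ ∞ :=
    (SchwartzMap.memLp (𝓕 f : SchwartzMap Sp ℂ) 2 volume).eLpNorm_ne_top
  have e2 : eLpNorm (⇑f) 2 volume ≠ ∞ := (f.memLp 2 volume).eLpNorm_ne_top
  have h2 := (ENNReal.toReal_eq_toReal_iff' e1 e2).1 h1
  rw [← h2, eLpNorm_eq_lintegral_rpow_enorm_toReal two_ne_zero ENNReal.ofNat_ne_top]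
  rw [← ENNReal.rpow_natCast, ← ENNReal.rpow_mul]
  simp

lemma Omega_radial_mul (i j : Fin 4) {φ : ℝ → ℂ} {h : Sp → ℂ} {x : Sp}
    (hφ : DifferentiableAt ℝ φ (‖x‖ ^ 2)) (hh : DifferentiableAt ℝ h x) :
    Omega i j (fun y => φ (‖y‖ ^ 2) * h y) x = φ (‖x‖ ^ 2) * Omega i j h x := by
  have h1 : HasFDerivAt (fun y : Sp => φ (‖y‖ ^ 2)) _ x :=
    HasFDerivAt.comp x hφ.hasFDerivAt (hasStrictFDerivAt_norm_sq x).hasFDerivAt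
  unfold Omega
  rw [(h1.fun_mul hh.hasFDerivAt).fderiv]
  simp [EuclideanSpace.inner_single_right]
  ring

/-- The multiplier `exp(2πit√r)`, as a function of `r = |ξ|²`. -/
def phase (t r : ℝ) : ℂ := cexp (2 * Real.pi * I * ((t * √r : ℝ) : ℂ))

lemma phase_norm_sq (t : ℝ) (ξ : Sp) :
    phase t (‖ξ‖ ^ 2) = cexp (2 * Real.pi * I * ((t * ‖ξ‖ : ℝ) : ℂ)) := by
  rw [phase, Real.sqrt_sq (norm_nonneg _)]

lemma contDiffAt_phase (t : ℝ) {r : ℝ} (hr : r ≠ 0) {n : ℕ∞} : ContDiffAt ℝ n (phase t) r := by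
  unfold phase
  have h1 : ContDiffAt ℝ n (fun r : ℝ => t * √r) r :=
    contDiffAt_const.mul (Real.contDiffAt_sqrt hr)
  exact (contDiffAt_const.mul (Complex.ofRealCLM.contDiff.contDiffAt.comp r h1)).cexp

lemma hw_eq_fourierInv {h : Sp → ℂ} (t : ℝ) (x : Sp) :
    hw h t x = 𝓕⁻ (fun ξ => phase t (‖ξ‖ ^ 2) * h ξ) x := by
  rw [Real.fourierInv_eq', hw]
  congr with ξ
  rw [phase_norm_sq, smul_eq_mul, ← mul_assoc, ← Complex.exp_add]
  congr 2
  rw [real_inner_comm]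
  push_cast
  ring

lemma exists_schwartz_phase_mul {k : SchwartzMap Sp ℂ}
    (hk : ∀ ξ, k ξ ≠ 0 → 1 / 2 ≤ ‖ξ‖ ∧ ‖ξ‖ ≤ 2) (t : ℝ) :
    ∃ g : SchwartzMap Sp ℂ, (∀ ξ, g ξ = phase t (‖ξ‖ ^ 2) * k ξ) ∧
      ∀ i j ξ, Omega i j g ξ = phase t (‖ξ‖ ^ 2) * Omega i j k ξ := by
  set G : Sp → ℂ := fun ξ => phase t (‖ξ‖ ^ 2) * k ξ with hG
  have hk0 : (⇑k) =ᶠ[nhds 0] fun _ => 0 := by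
    filter_upwards [Metric.ball_mem_nhds (0 : Sp) (show (0 : ℝ) < 1 / 2 by norm_num)] with ξ hξ
    by_contra hne
    have := (hk ξ hne).1
    rw [mem_ball_zero_iff] at hξ
    linarith
  have hG0 : G =ᶠ[nhds 0] fun _ => 0 := by
    filter_upwards [hk0] with ξ hξ
    simp [hG, hξ]
  have hsmooth : ContDiff ℝ ((⊤ : ℕ∞) : WithTop ℕ∞) G := by
    rw [contDiff_iff_contDiffAt]
    intro ξ
    by_cases h0 : ξ = 0
    · rw [h0]
      exact contDiffAt_const.congr_of_eventuallyEq hG0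
    · refine ContDiffAt.mul ?_ (k.smooth ⊤).contDiffAt
      exact (contDiffAt_phase t (by positivity)).comp ξ (contDiff_norm_sq ℝ).contDiffAt
  have hsupp : HasCompactSupport G := by
    refine HasCompactSupport.intro (isCompact_closedBall (0 : Sp) 2) fun ξ hξ => ?_
    by_contra hne
    rw [mem_closedBall_zero_iff] at hξ
    exact hξ (hk ξ (right_ne_zero_of_mul hne)).2
  refine ⟨hsupp.toSchwartzMap hsmooth, fun ξ => rfl, fun i j ξ => ?_⟩
  change Omega i j G ξ = _
  by_cases h0 : ξ = 0
  · have h1 : fderiv ℝ G 0 = 0 := by rw [hG0.fderiv_eq]; simp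
    have h2 : fderiv ℝ k 0 = 0 := by rw [hk0.fderiv_eq]; simp
    simp [Omega, h0, h1, h2]
  · exact Omega_radial_mul i j
      ((contDiffAt_phase t (n := 1) (by positivity)).differentiableAt one_ne_zero)
      k.differentiableAt

lemma exists_schwartz_halfWave {f : SchwartzMap Sp ℂ} (hf : UnitFrequency f) (t : ℝ) :
    ∃ v : SchwartzMap Sp ℂ, (⇑v = halfWave f t) ∧
      ∀ i j x, Omega i j v x = hw (𝓕 (schwartzOmega i j f) : SchwartzMap Sp ℂ) t x := by
  obtain ⟨g, hg, hgO⟩ := exists_schwartz_phase_mul (k := 𝓕 f) hf t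
  refine ⟨𝓕⁻ g, ?_, fun i j x => ?_⟩
  · ext x
    change _ = hw (𝓕 f : SchwartzMap Sp ℂ) t x
    rw [hw_eq_fourierInv, SchwartzMap.fourierInv_coe]
    exact congrArg (fun G : Sp → ℂ => 𝓕⁻ G x) (funext hg)
  · rw [← schwartzOmega_apply, ← fourierInv_schwartzOmega, hw_eq_fourierInv,
      SchwartzMap.fourierInv_coe]
    refine congrArg (fun G : Sp → ℂ => 𝓕⁻ G x) (funext fun ξ => ?_)
    rw [fourier_schwartzOmega, schwartzOmega_apply, schwartzOmega_apply, hgO]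

/-- Minkowski's integral inequality with values in `ℓ^q`. -/
lemma tsum_lintegral_rpow_le {ι X : Type*} [MeasurableSpace X] {ν : Measure X} {q : ℝ}
    (hq : 1 < q) {b : ι → X → ℝ≥0∞} (hb : ∀ a, Measurable (b a)) :
    ∑' a, (∫⁻ r, b a r ∂ν) ^ q ≤ (∫⁻ r, (∑' a, b a r ^ q) ^ (1 / q) ∂ν) ^ q := by
  have hq0 : 0 < q := by linarith
  set A : ι → ℝ≥0∞ := fun a => ∫⁻ r, b a r ∂ν with hA
  set R := ∫⁻ r, (∑' a, b a r ^ q) ^ (1 / q) ∂ν with hR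
  by_cases hRtop : R = ∞
  · rw [hRtop, ENNReal.top_rpow_of_pos hq0]
    exact le_top
  have hAR : ∀ a, A a ≤ R := fun a => by
    refine lintegral_mono fun r => ?_
    calc b a r = (b a r ^ q) ^ (1 / q) := by
          rw [← ENNReal.rpow_mul, mul_one_div_cancel hq0.ne', ENNReal.rpow_one]
      _ ≤ _ := by gcongr; exact ENNReal.le_tsum a
  have hAtop : ∀ a, A a ≠ ∞ := fun a => ne_top_of_le_ne_top hRtop (hAR a)
  rw [ENNReal.tsum_eq_iSup_sum]
  refine iSup_le fun T => ?_
  set Z := ∑ a ∈ T, A a ^ q with hZ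
  have hpq : q.HolderConjugate (Real.conjExponent q) := Real.HolderConjugate.conjExponent hq
  set q' := Real.conjExponent q
  have hZtop : Z ≠ ∞ := by
    refine (ENNReal.sum_lt_top.2 fun a _ => ?_).ne
    exact ENNReal.rpow_lt_top_of_nonneg hq0.le (hAtop a)
  have h1 : Z ≤ R * Z ^ (1 / q') := by
    calc Z = ∑ a ∈ T, ∫⁻ r, b a r * A a ^ (q - 1) ∂ν := by
          refine Finset.sum_congr rfl fun a _ => ?_
          rw [lintegral_mul_const _ (hb a)]
          change _ = A a * A a ^ (q - 1)
          nth_rewrite 2 [← ENNReal.rpow_one (A a)]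
          rw [← ENNReal.rpow_add_of_nonneg _ _ zero_le_one (by linarith)]
          congr 1; ring
      _ = ∫⁻ r, ∑ a ∈ T, b a r * A a ^ (q - 1) ∂ν :=
          (lintegral_finsetSum _ fun a _ => (hb a).mul_const _).symm
      _ ≤ ∫⁻ r, (∑' a, b a r ^ q) ^ (1 / q) * Z ^ (1 / q') ∂ν := by
          refine lintegral_mono fun r => (ENNReal.inner_le_Lp_mul_Lq T _ _ hpq).trans ?_
          have h2 : ∀ a, (A a ^ (q - 1)) ^ q' = A a ^ q := fun a => by
            rw [← ENNReal.rpow_mul, hpq.sub_one_mul_conj]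
          simp_rw [h2]
          gcongr
          exact ENNReal.sum_le_tsum T
      _ = _ := lintegral_mul_const' _ _
          (ENNReal.rpow_ne_top_of_nonneg (by have := hpq.symm.pos; positivity) hZtop)
  by_cases hZ0 : Z = 0
  · rw [hZ0]; exact bot_le
  have h2 : Z = Z ^ (1 / q) * Z ^ (1 / q') := by
    rw [← ENNReal.rpow_add _ _ hZ0 hZtop, one_div, one_div, hpq.inv_add_inv_eq_one,
      ENNReal.rpow_one]
  have h3 : Z ^ (1 / q) ≤ R := by
    nth_rewrite 1 [h2] at h1
    refine (ENNReal.mul_le_mul_iff_left ?_ ?_).1 h1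
    · exact (ENNReal.rpow_pos (pos_iff_ne_zero.2 hZ0) hZtop).ne'
    · exact ENNReal.rpow_ne_top_of_nonneg (by have := hpq.symm.pos; positivity) hZtop
  calc Z = (Z ^ (1 / q)) ^ q := by
        rw [← ENNReal.rpow_mul, one_div_mul_cancel hq0.ne', ENNReal.rpow_one]
    _ ≤ R ^ q := by gcongr

/-- The point of the sphere of radius `r` over `y`, on the side given by the sign `σ`. -/
def spherePoint (i : Fin 4) (σ r : ℝ) (y : Fin 3 → ℝ) : Sp :=
  ins i (σ * √(r ^ 2 - ∑ j, y j ^ 2)) y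

lemma continuous_spherePoint (i : Fin 4) (σ : ℝ) :
    Continuous fun p : ℝ × (Fin 3 → ℝ) => spherePoint i σ p.1 p.2 := by
  unfold spherePoint
  exact (continuous_ins i).comp
    (f := fun p : ℝ × (Fin 3 → ℝ) => (σ * √(p.1 ^ 2 - ∑ j, p.2 j ^ 2), p.2)) (by fun_prop)

lemma norm_spherePoint (i : Fin 4) {σ r : ℝ} (hσ : σ ^ 2 = 1) (hr : 0 ≤ r) {y : Fin 3 → ℝ}
    (hy : ∑ j, y j ^ 2 ≤ r ^ 2) : ‖spherePoint i σ r y‖ = r := by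
  have h := norm_ins_sq i (σ * √(r ^ 2 - ∑ j, y j ^ 2)) y
  rw [mul_pow, hσ, Real.sq_sqrt (by linarith), one_mul, sub_add_cancel] at h
  exact (pow_left_inj₀ (norm_nonneg _) hr two_ne_zero).1 h

lemma lintegral_halfLine_eq {σ ρ2 : ℝ} (hσ : σ ^ 2 = 1) (hρ : 0 ≤ ρ2) (W : ℝ → ℝ≥0∞) :
    ∫⁻ s in {s | 0 < σ * s}, W s =
      ∫⁻ r in {r | 0 < r ∧ ρ2 < r ^ 2}, ENNReal.ofReal (r / √(r ^ 2 - ρ2)) *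
        W (σ * √(r ^ 2 - ρ2)) := by
  have hσ1 : |σ| = 1 := by
    rw [← sq_abs] at hσ
    exact (pow_eq_one_iff_of_nonneg (abs_nonneg _) two_ne_zero).1 hσ
  have hset : MeasurableSet {r : ℝ | 0 < r ∧ ρ2 < r ^ 2} :=
    (measurableSet_lt measurable_const measurable_id).inter
      (measurableSet_lt measurable_const (by fun_prop : Measurable fun r : ℝ => r ^ 2))
  have himg : (fun r => σ * √(r ^ 2 - ρ2)) '' {r | 0 < r ∧ ρ2 < r ^ 2} = {s | 0 < σ * s} := by
    ext s
    simp only [Set.mem_image, Set.mem_ofPred_eq]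
    constructor
    · rintro ⟨r, ⟨_, h2⟩, rfl⟩
      rw [← mul_assoc, ← sq, hσ, one_mul]
      exact Real.sqrt_pos.2 (by linarith)
    · intro hs
      have hs2 : 0 < s ^ 2 := by
        have : s ≠ 0 := by rintro rfl; simp at hs
        positivity
      refine ⟨√(s ^ 2 + ρ2), ⟨Real.sqrt_pos.2 (by linarith), ?_⟩, ?_⟩
      · rw [Real.sq_sqrt (by linarith)]; linarith
      · rw [Real.sq_sqrt (by linarith), add_sub_cancel_right]
        have : s ^ 2 = (σ * s) ^ 2 := by rw [mul_pow, hσ, one_mul]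
        rw [this, Real.sqrt_sq hs.le, ← mul_assoc, ← sq, hσ, one_mul]
  have hinj : Set.InjOn (fun r => σ * √(r ^ 2 - ρ2)) {r | 0 < r ∧ ρ2 < r ^ 2} := by
    rintro r ⟨hr, hr2⟩ r' ⟨hr', hr2'⟩ h
    have hσ0 : σ ≠ 0 := by rintro rfl; simp at hσ
    have h1 := mul_left_cancel₀ hσ0 h
    rw [Real.sqrt_inj (by linarith) (by linarith)] at h1
    exact (pow_left_inj₀ hr.le hr'.le two_ne_zero).1 (by linarith)
  have hder : ∀ r ∈ {r : ℝ | 0 < r ∧ ρ2 < r ^ 2}, HasDerivWithinAt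
      (fun r => σ * √(r ^ 2 - ρ2)) (σ * (r / √(r ^ 2 - ρ2))) {r | 0 < r ∧ ρ2 < r ^ 2} r := by
    rintro r ⟨hr, hr2⟩
    have h1 : HasDerivAt (fun r : ℝ => r ^ 2 - ρ2) (2 * r) r := by
      simpa using (hasDerivAt_pow 2 r).sub_const ρ2
    have h2 := (h1.sqrt (by linarith)).const_mul σ
    rw [mul_div_mul_left _ _ two_ne_zero] at h2
    exact h2.hasDerivWithinAt
  rw [← himg, lintegral_image_eq_lintegral_abs_deriv_mul hset hder hinj]
  refine setLIntegral_congr_fun hset fun r hr => ?_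
  have : 0 ≤ r / √(r ^ 2 - ρ2) := div_nonneg hr.1.le (Real.sqrt_nonneg _)
  simp only [abs_mul, hσ1, one_mul, abs_of_nonneg this]

lemma lintegral_halfSpace_eq (i : Fin 4) {σ : ℝ} (hσ : σ ^ 2 = 1) {w : Sp → ℝ≥0∞}
    (hw : Measurable w) :
    ∫⁻ x in {x : Sp | 0 < σ * x i}, w x =
      ∫⁻ r in Set.Ioi 0, ∫⁻ y in {y : Fin 3 → ℝ | ∑ j, y j ^ 2 < r ^ 2},
        ENNReal.ofReal (r / √(r ^ 2 - ∑ j, y j ^ 2)) * w (spherePoint i σ r y) := by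
  have hm1 : MeasurableSet {x : Sp | 0 < σ * x i} :=
    measurableSet_lt measurable_const (by fun_prop)
  have hmr : ∀ y : Fin 3 → ℝ, MeasurableSet {r : ℝ | 0 < r ∧ ∑ j, y j ^ 2 < r ^ 2} := fun y =>
    (measurableSet_lt measurable_const measurable_id).inter
      (measurableSet_lt measurable_const (by fun_prop : Measurable fun r : ℝ => r ^ 2))
  have hmy : ∀ r : ℝ, MeasurableSet {y : Fin 3 → ℝ | ∑ j, y j ^ 2 < r ^ 2} := fun r =>
    measurableSet_lt (by fun_prop) measurable_const
  have hms : MeasurableSet {s : ℝ | 0 < σ * s} := measurableSet_lt measurable_const (by fun_prop)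
  set Φ : ℝ → (Fin 3 → ℝ) → ℝ≥0∞ := fun r y =>
    ENNReal.ofReal (r / √(r ^ 2 - ∑ j, y j ^ 2)) * w (spherePoint i σ r y) with hΦ
  have hΦm : Measurable fun p : ℝ × (Fin 3 → ℝ) => Φ p.1 p.2 :=
    (by fun_prop : Measurable fun p : ℝ × (Fin 3 → ℝ) =>
      ENNReal.ofReal (p.1 / √(p.1 ^ 2 - ∑ j, p.2 j ^ 2))).mul
      (hw.comp (continuous_spherePoint i σ).measurable)
  have hset2 : MeasurableSet {p : ℝ × (Fin 3 → ℝ) | 0 < p.1 ∧ ∑ j, p.2 j ^ 2 < p.1 ^ 2} :=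
    (measurableSet_lt measurable_const measurable_fst).inter
      (measurableSet_lt (by fun_prop : Measurable fun p : ℝ × (Fin 3 → ℝ) => ∑ j, p.2 j ^ 2)
        (by fun_prop : Measurable fun p : ℝ × (Fin 3 → ℝ) => p.1 ^ 2))
  calc _ = ∫⁻ s, ∫⁻ y, {s : ℝ | 0 < σ * s}.indicator (fun s => w (ins i s y)) s := by
        rw [← lintegral_indicator hm1, lintegral_ins i (hw.indicator hm1)]
        congr with s
        congr with y
        simp [Set.indicator_apply]
    _ = ∫⁻ y, ∫⁻ s in {s | 0 < σ * s}, w (ins i s y) := by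
        rw [lintegral_lintegral_swap]
        · congr with y
          rw [lintegral_indicator hms]
        · exact ((hw.comp (continuous_ins i).measurable).indicator
            (measurable_fst hms)).aemeasurable
    _ = ∫⁻ y, ∫⁻ r, {p : ℝ × (Fin 3 → ℝ) | 0 < p.1 ∧ ∑ j, p.2 j ^ 2 < p.1 ^ 2}.indicator
          (fun p => Φ p.1 p.2) (r, y) := by
        congr with y
        rw [lintegral_halfLine_eq hσ (show 0 ≤ ∑ j, y j ^ 2 by positivity),
          ← lintegral_indicator (hmr y)]
        rfl
    _ = ∫⁻ r, ∫⁻ y, {p : ℝ × (Fin 3 → ℝ) | 0 < p.1 ∧ ∑ j, p.2 j ^ 2 < p.1 ^ 2}.indicator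
          (fun p => Φ p.1 p.2) (r, y) := by
        rw [lintegral_lintegral_swap]
        exact ((hΦm.indicator hset2).comp measurable_swap).aemeasurable
    _ = _ := by
        rw [← lintegral_indicator measurableSet_Ioi]
        congr with r
        by_cases hr : 0 < r
        · rw [Set.indicator_of_mem (Set.mem_Ioi.2 hr), ← lintegral_indicator (hmy r)]
          congr with y
          simp [Set.indicator_apply, hr, hΦ]
        · rw [Set.indicator_of_notMem (by simpa using hr)]
          simp [hr]

lemma exists_bound_deriv_smoothTransition :
    ∃ M : ℝ, 0 ≤ M ∧ ∀ x, |deriv Real.smoothTransition x| ≤ M := by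
  have hc : Continuous (deriv Real.smoothTransition) :=
    (Real.smoothTransition.contDiff (n := 1)).continuous_deriv le_rfl
  obtain ⟨M, hM⟩ := (isCompact_Icc (a := (0 : ℝ)) (b := 1)).exists_bound_of_continuousOn
    hc.continuousOn
  have hM0 : 0 ≤ M := (norm_nonneg _).trans (hM 0 (by simp))
  refine ⟨M, hM0, fun x => ?_⟩
  by_cases h0 : x < 0
  · have : Real.smoothTransition =ᶠ[nhds x] fun _ => 0 := by
      filter_upwards [Iio_mem_nhds h0] with z hz
      exact Real.smoothTransition.zero_of_nonpos hz.le
    rw [this.deriv_eq]; simpa using hM0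
  by_cases h1 : 1 < x
  · have : Real.smoothTransition =ᶠ[nhds x] fun _ => 1 := by
      filter_upwards [Ioi_mem_nhds h1] with z hz
      exact Real.smoothTransition.one_of_one_le hz.le
    rw [this.deriv_eq]; simpa using hM0
  · exact hM x ⟨not_lt.1 h0, not_lt.1 h1⟩

lemma ins_eq_sum (i : Fin 4) (s : ℝ) (y : Fin 3 → ℝ) :
    ins i s y = s • EuclideanSpace.single i (1 : ℝ) +
      ∑ j, y j • EuclideanSpace.single (i.succAbove j) (1 : ℝ) := by
  ext k
  rcases eq_or_ne k i with rfl | hk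
  · simp
  · obtain ⟨j, rfl⟩ := Fin.exists_succAbove_eq hk
    simp [Pi.single_apply, Fin.succAbove_ne]

lemma hasFDerivAt_sum_sq (y : Fin 3 → ℝ) :
    HasFDerivAt (fun y : Fin 3 → ℝ => ∑ j, y j ^ 2)
      (∑ j, (2 * y j) • (ContinuousLinearMap.proj j : (Fin 3 → ℝ) →L[ℝ] ℝ)) y := by
  refine HasFDerivAt.fun_sum fun j _ => ?_
  simpa using (hasFDerivAt_apply (𝕜 := ℝ) j y).pow 2

lemma hasFDerivAt_comp_spherePoint (i : Fin 4) {σ r : ℝ} (hσ : σ ^ 2 = 1) {v : Sp → ℂ}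
    {y : Fin 3 → ℝ} (hy : ∑ j, y j ^ 2 < r ^ 2)
    (hv : DifferentiableAt ℝ v (spherePoint i σ r y)) :
    HasFDerivAt (fun y => v (spherePoint i σ r y))
      (∑ j, (ContinuousLinearMap.proj j : (Fin 3 → ℝ) →L[ℝ] ℝ).smulRight
        ((σ / √(r ^ 2 - ∑ j, y j ^ 2)) • Omega i (i.succAbove j) v (spherePoint i σ r y))) y := by
  set s := √(r ^ 2 - ∑ j, y j ^ 2) with hs
  have hs0 : 0 < s := Real.sqrt_pos.2 (by linarith)
  have h1 := ((hasFDerivAt_sum_sq y).const_sub (r ^ 2)).sqrt (by linarith)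
  have h2 := ((h1.const_mul σ).smul_const (EuclideanSpace.single i (1 : ℝ) : Sp)).fun_add
    (HasFDerivAt.fun_sum (u := Finset.univ) fun j _ =>
      (hasFDerivAt_apply (𝕜 := ℝ) j y).smul_const
        (EuclideanSpace.single (i.succAbove j) (1 : ℝ) : Sp))
  have h3 : (fun y : Fin 3 → ℝ =>
      (σ * √(r ^ 2 - ∑ j, y j ^ 2)) • (EuclideanSpace.single i (1 : ℝ) : Sp)
      + ∑ j, y j • (EuclideanSpace.single (i.succAbove j) (1 : ℝ) : Sp)) = spherePoint i σ r := by
    ext1 z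
    rw [spherePoint, ins_eq_sum]
  rw [h3] at h2
  have h5 := hv.hasFDerivAt.comp y h2
  refine h5.congr_fderiv ?_
  ext h
  have e1 : spherePoint i σ r y i = σ * s := ins_same _ _ _
  have e2 : ∀ j, spherePoint i σ r y (i.succAbove j) = y j := fun j => ins_succAbove _ _ _ _
  have hsc : (s : ℂ) ≠ 0 := by exact_mod_cast hs0.ne'
  have hσc : (σ : ℂ) ^ 2 = 1 := by exact_mod_cast hσ
  have hs' : √(r ^ 2 - (y 0 ^ 2 + y 1 ^ 2 + y 2 ^ 2)) = s := by rw [hs, Fin.sum_univ_three]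
  simp [Omega, e1, e2, Fin.sum_univ_three, hs']
  field_simp
  generalize fderiv ℝ v (spherePoint i σ r y) = L
  linear_combination (-(s : ℂ) * (h 0 * L (EuclideanSpace.single (i.succAbove 0) (1 : ℝ)) +
    h 1 * L (EuclideanSpace.single (i.succAbove 1) (1 : ℝ)) +
    h 2 * L (EuclideanSpace.single (i.succAbove 2) (1 : ℝ)))) * hσc

/-- A function restricted to a sphere and cut off to a cap, as a function of three coordinates. -/
def cap (i : Fin 4) (σ r : ℝ) (v : Sp → ℂ) (y : Fin 3 → ℝ) : ℂ :=
  Real.smoothTransition (8 * (1 - (∑ j, y j ^ 2) / r ^ 2) - 1) • v (spherePoint i σ r y)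

lemma cap_eq_zero (i : Fin 4) (σ : ℝ) {r : ℝ} (hr : 0 < r) (v : Sp → ℂ) {y : Fin 3 → ℝ}
    (hy : 7 / 8 * r ^ 2 ≤ ∑ j, y j ^ 2) : cap i σ r v y = 0 := by
  have h : 7 / 8 ≤ (∑ j, y j ^ 2) / r ^ 2 := by rwa [le_div_iff₀ (by positivity)]
  rw [cap, Real.smoothTransition.zero_of_nonpos (by linarith), zero_smul]

lemma cap_eq (i : Fin 4) (σ : ℝ) {r : ℝ} (hr : 0 < r) (v : Sp → ℂ) {y : Fin 3 → ℝ}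
    (hy : ∑ j, y j ^ 2 ≤ 3 / 4 * r ^ 2) : cap i σ r v y = v (spherePoint i σ r y) := by
  have h : (∑ j, y j ^ 2) / r ^ 2 ≤ 3 / 4 := by rwa [div_le_iff₀ (by positivity)]
  rw [cap, Real.smoothTransition.one_of_one_le (by linarith), one_smul]

lemma enorm_cap_le (i : Fin 4) (σ r : ℝ) (v : Sp → ℂ) (y : Fin 3 → ℝ) :
    ‖cap i σ r v y‖ₑ ≤ ‖v (spherePoint i σ r y)‖ₑ := by
  rw [← ofReal_norm, ← ofReal_norm]
  refine ENNReal.ofReal_le_ofReal ?_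
  rw [cap, norm_smul, Real.norm_of_nonneg (Real.smoothTransition.nonneg _)]
  exact mul_le_of_le_one_left (norm_nonneg _) (Real.smoothTransition.le_one _)

lemma contDiffAt_spherePoint (i : Fin 4) (σ : ℝ) {r : ℝ} {y : Fin 3 → ℝ}
    (hy : ∑ j, y j ^ 2 < r ^ 2) : ContDiffAt ℝ 1 (spherePoint i σ r) y := by
  have h3 : spherePoint i σ r = fun y : Fin 3 → ℝ =>
      (σ * √(r ^ 2 - ∑ j, y j ^ 2)) • (EuclideanSpace.single i (1 : ℝ) : Sp)
      + ∑ j, y j • (EuclideanSpace.single (i.succAbove j) (1 : ℝ) : Sp) := by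
    ext1 z
    rw [spherePoint, ins_eq_sum]
  rw [h3]
  have h1 : ContDiffAt ℝ 1 (fun y : Fin 3 → ℝ => r ^ 2 - ∑ j, y j ^ 2) y := by fun_prop
  have h2 := h1.sqrt (by linarith)
  fun_prop

lemma cap_eventuallyEq_zero (i : Fin 4) (σ : ℝ) {r : ℝ} (hr : 0 < r) (v : Sp → ℂ)
    {y : Fin 3 → ℝ} (hy : 7 / 8 * r ^ 2 < ∑ j, y j ^ 2) :
    cap i σ r v =ᶠ[nhds y] fun _ => 0 := by
  have ho : IsOpen {y : Fin 3 → ℝ | 7 / 8 * r ^ 2 < ∑ j, y j ^ 2} :=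
    isOpen_lt continuous_const (by fun_prop)
  filter_upwards [ho.mem_nhds hy] with z hz
  exact cap_eq_zero i σ hr v (le_of_lt hz)

lemma contDiff_cap (i : Fin 4) (σ : ℝ) {r : ℝ} (hr : 0 < r) {v : Sp → ℂ}
    (hv : ContDiff ℝ 1 v) : ContDiff ℝ 1 (cap i σ r v) := by
  rw [contDiff_iff_contDiffAt]
  intro y
  by_cases hy : ∑ j, y j ^ 2 < r ^ 2
  · have h1 : ContDiffAt ℝ 1 (fun y : Fin 3 → ℝ => 8 * (1 - (∑ j, y j ^ 2) / r ^ 2) - 1) y := by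
      fun_prop
    have h2 := (Real.smoothTransition.contDiff (n := 1)).contDiffAt.comp y h1
    exact h2.smul (hv.contDiffAt.comp y (contDiffAt_spherePoint i σ hy))
  · refine contDiffAt_const.congr_of_eventuallyEq (cap_eventuallyEq_zero i σ hr v ?_)
    have := sq_pos_of_pos hr
    linarith

lemma abs_le_of_sum_sq_le {r : ℝ} (hr : 0 ≤ r) {y : Fin 3 → ℝ} (hy : ∑ j, y j ^ 2 ≤ r ^ 2)
    (j : Fin 3) : |y j| ≤ r :=
  abs_le_of_sq_le_sq (a := y j) ((Finset.single_le_sum (f := fun j => y j ^ 2)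
    (fun _ _ => sq_nonneg _) (Finset.mem_univ j)).trans hy) hr

lemma hasCompactSupport_cap (i : Fin 4) (σ : ℝ) {r : ℝ} (hr : 0 < r) (v : Sp → ℂ) :
    HasCompactSupport (cap i σ r v) := by
  refine HasCompactSupport.intro (isCompact_closedBall (0 : Fin 3 → ℝ) r) fun y hy => ?_
  refine cap_eq_zero i σ hr v ?_
  by_contra! h
  refine hy ?_
  rw [mem_closedBall_zero_iff, pi_norm_le_iff_of_nonneg hr.le]
  exact fun j => abs_le_of_sum_sq_le hr.le (by nlinarith [sq_pos_of_pos hr]) j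

lemma norm_sum_proj_smulRight_le {F : Type*} [NormedAddCommGroup F] [NormedSpace ℝ F]
    (c : Fin 3 → F) :
    ‖∑ j, (ContinuousLinearMap.proj j : (Fin 3 → ℝ) →L[ℝ] ℝ).smulRight (c j)‖ ≤ ∑ j, ‖c j‖ := by
  refine ContinuousLinearMap.opNorm_le_bound _ (by positivity) fun h => ?_
  rw [_root_.sum_apply, Finset.sum_mul]
  refine norm_sum_le_of_le _ fun j _ => ?_
  rw [ContinuousLinearMap.smulRight_apply, norm_smul, mul_comm]
  exact mul_le_mul_of_nonneg_left (norm_le_pi_norm h j) (norm_nonneg _)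

lemma exists_norm_fderiv_cap_le : ∃ K : ℝ, 0 ≤ K ∧ ∀ (i : Fin 4) {σ r : ℝ}, σ ^ 2 = 1 → 0 < r →
    ∀ {v : Sp → ℂ}, ContDiff ℝ 1 v → ∀ {y : Fin 3 → ℝ}, ∑ j, y j ^ 2 ≤ 7 / 8 * r ^ 2 →
      ‖fderiv ℝ (cap i σ r v) y‖ ≤ K / r * (‖v (spherePoint i σ r y)‖ +
        ∑ j, ‖Omega i (i.succAbove j) v (spherePoint i σ r y)‖) := by
  obtain ⟨M, hM0, hM⟩ := exists_bound_deriv_smoothTransition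
  refine ⟨48 * M + 3, by positivity, fun i σ r hσ hr v hv y hy => ?_⟩
  have hr2 := sq_pos_of_pos hr
  have hy' : ∑ j, y j ^ 2 < r ^ 2 := by linarith
  have h1 := hasFDerivAt_comp_spherePoint i hσ hy' (hv.differentiable (by simp) _)
  have h2 := (((hasFDerivAt_sum_sq y).mul_const (r ^ 2)⁻¹).const_sub 1).const_mul 8 |>.sub_const 1
  have h3 := ((Real.smoothTransition.contDiff (n := 1)).differentiable (by simp)
    (8 * (1 - (∑ j, y j ^ 2) * (r ^ 2)⁻¹) - 1)).hasDerivAt.comp_hasFDerivAt y h2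
  have h4 := h3.fun_smul h1
  have h5 : (fun y => (Real.smoothTransition ∘ fun y : Fin 3 → ℝ =>
      8 * (1 - (∑ j, y j ^ 2) * (r ^ 2)⁻¹) - 1) y • v (spherePoint i σ r y)) = cap i σ r v := by
    ext1 z
    simp only [cap, div_eq_mul_inv, Function.comp]
  rw [h5] at h4
  rw [h4.fderiv]
  have hs : r / 3 ≤ √(r ^ 2 - ∑ j, y j ^ 2) := by
    refine Real.le_sqrt_of_sq_le ?_
    nlinarith
  have hs0 : 0 < √(r ^ 2 - ∑ j, y j ^ 2) := lt_of_lt_of_le (by positivity) hs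
  have hσ1 : |σ| = 1 := by
    rw [← sq_abs] at hσ
    exact (pow_eq_one_iff_of_nonneg (abs_nonneg _) two_ne_zero).1 hσ
  have hσs : ‖σ / √(r ^ 2 - ∑ j, y j ^ 2)‖ ≤ 3 / r := by
    rw [norm_div, Real.norm_eq_abs, hσ1, Real.norm_of_nonneg hs0.le,
      div_le_div_iff₀ hs0 hr]
    linarith
  have hlin : ‖∑ j, (2 * y j) • (ContinuousLinearMap.proj j : (Fin 3 → ℝ) →L[ℝ] ℝ)‖ ≤ 6 * r := by
    calc _ ≤ ∑ j : Fin 3, 2 * r := by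
          refine norm_sum_le_of_le _ fun j _ => ?_
          refine ContinuousLinearMap.opNorm_le_bound _ (by positivity) fun h => ?_
          have := abs_le_of_sum_sq_le hr.le hy'.le j
          simp only [_root_.smul_apply, ContinuousLinearMap.proj_apply, norm_smul,
            norm_mul, Real.norm_eq_abs, abs_two]
          have h6 := norm_le_pi_norm h j
          rw [Real.norm_eq_abs] at h6
          gcongr
      _ = 6 * r := by simp; ring
  refine (norm_add_le _ _).trans ?_
  rw [mul_add, add_comm]
  refine add_le_add ?_ ?_
  · rw [ContinuousLinearMap.norm_smulRight_apply]
    refine mul_le_mul_of_nonneg_right ?_ (norm_nonneg _)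
    rw [norm_smul, norm_smul, norm_neg, norm_smul, Real.norm_eq_abs]
    calc _ ≤ M * (‖(8:ℝ)‖ * (‖(r ^ 2)⁻¹‖ * (6 * r))) := by gcongr; exact hM _
      _ ≤ (48 * M + 3) / r := by
        rw [norm_inv, Real.norm_of_nonneg hr2.le, Real.norm_of_nonneg (by norm_num)]
        rw [le_div_iff₀ hr]
        field_simp
        linarith
  · rw [norm_smul]
    calc _ ≤ 1 * ∑ j, ‖(σ / √(r ^ 2 - ∑ j, y j ^ 2)) •
          Omega i (i.succAbove j) v (spherePoint i σ r y)‖ := by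
          refine mul_le_mul ?_ (norm_sum_proj_smulRight_le _) (norm_nonneg _) zero_le_one
          rw [Function.comp, Real.norm_of_nonneg (Real.smoothTransition.nonneg _)]
          exact Real.smoothTransition.le_one _
      _ ≤ _ := by
        rw [one_mul, Finset.mul_sum]
        refine Finset.sum_le_sum fun j _ => ?_
        rw [norm_smul]
        refine mul_le_mul_of_nonneg_right (hσs.trans ?_) (norm_nonneg _)
        gcongr
        linarith

/-- Pointwise energy density including all first-order rotational derivatives. -/
def angEnergy (v : Sp → ℂ) (x : Sp) : ℝ≥0∞ :=
  ‖v x‖ₑ ^ 2 + ∑ i, ∑ j, ‖Omega i j v x‖ₑ ^ 2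

lemma continuous_Omega (i j : Fin 4) {v : Sp → ℂ} (hv : ContDiff ℝ 1 v) :
    Continuous (Omega i j v) := by
  have h := hv.continuous_fderiv (by simp)
  unfold Omega
  fun_prop

lemma measurable_angEnergy {v : Sp → ℂ} (hv : ContDiff ℝ 1 v) : Measurable (angEnergy v) := by
  have h0 := hv.continuous.measurable
  have h := fun i j => (continuous_Omega i j hv).measurable
  unfold angEnergy
  fun_prop

/-- The energy density integrated over a spherical cap, in graph coordinates. -/
def capEnergy (i : Fin 4) (σ r : ℝ) (v : Sp → ℂ) : ℝ≥0∞ :=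
  ∫⁻ y in {y : Fin 3 → ℝ | ∑ j, y j ^ 2 ≤ 7 / 8 * r ^ 2}, angEnergy v (spherePoint i σ r y)

lemma measurableSet_capDomain (r : ℝ) :
    MeasurableSet {y : Fin 3 → ℝ | ∑ j, y j ^ 2 ≤ 7 / 8 * r ^ 2} :=
  measurableSet_le (by fun_prop) measurable_const

lemma lintegral_cap_sq_le (i : Fin 4) (σ : ℝ) {r : ℝ} (hr : 0 < r) (v : Sp → ℂ) :
    ∫⁻ y, ‖cap i σ r v y‖ₑ ^ 2 ≤ capEnergy i σ r v := by
  rw [capEnergy, ← lintegral_indicator (measurableSet_capDomain r)]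
  refine lintegral_mono fun y => ?_
  by_cases hy : ∑ j, y j ^ 2 ≤ 7 / 8 * r ^ 2
  · rw [Set.indicator_of_mem (by exact hy), angEnergy]
    refine le_add_right ?_
    gcongr
    exact enorm_cap_le i σ r v y
  · rw [cap_eq_zero i σ hr v (not_le.1 hy).le]
    simp

lemma sq_add_sum_le (a : ℝ≥0∞) (b : Fin 3 → ℝ≥0∞) :
    (a + ∑ j, b j) ^ 2 ≤ 4 * (a ^ 2 + ∑ j, b j ^ 2) := by
  have h := ENNReal.inner_le_Lp_mul_Lq Finset.univ (Fin.cons a b : Fin 4 → ℝ≥0∞) (fun _ => 1)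
    Real.HolderConjugate.two_two
  have h2 := pow_le_pow_left' h 2
  simp only [mul_one, Fin.sum_univ_succ (n := 3), Fin.cons_zero, Fin.cons_succ, ENNReal.one_rpow,
    mul_pow, ← ENNReal.rpow_natCast, ← ENNReal.rpow_mul] at h2
  norm_num at h2
  rw [mul_comm]
  convert h2 using 2

lemma exists_lintegral_fderiv_cap_sq_le : ∃ K : ℝ, 0 ≤ K ∧ ∀ (i : Fin 4) {σ r : ℝ}, σ ^ 2 = 1 →
    0 < r → ∀ {v : Sp → ℂ}, ContDiff ℝ 1 v →
      ∫⁻ y, ‖fderiv ℝ (cap i σ r v) y‖ₑ ^ 2 ≤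
        ENNReal.ofReal (K / r) ^ 2 * 4 * capEnergy i σ r v := by
  obtain ⟨K, hK0, hK⟩ := exists_norm_fderiv_cap_le
  refine ⟨K, hK0, fun i σ r hσ hr v hv => ?_⟩
  have hfin : ENNReal.ofReal (K / r) ^ 2 * 4 ≠ ∞ := by finiteness
  rw [capEnergy, ← lintegral_indicator (measurableSet_capDomain r), ← lintegral_const_mul' _ _ hfin]
  refine lintegral_mono fun y => ?_
  by_cases hy : ∑ j, y j ^ 2 ≤ 7 / 8 * r ^ 2
  · rw [Set.indicator_of_mem (by exact hy)]
    have h1 : ‖fderiv ℝ (cap i σ r v) y‖ₑ ≤ ENNReal.ofReal (K / r) *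
        (‖v (spherePoint i σ r y)‖ₑ + ∑ j, ‖Omega i (i.succAbove j) v (spherePoint i σ r y)‖ₑ) := by
      have h2 := ENNReal.ofReal_le_ofReal (hK i hσ hr hv hy)
      rwa [ofReal_norm, ENNReal.ofReal_mul (by positivity), ENNReal.ofReal_add (by positivity)
        (by positivity), ENNReal.ofReal_sum_of_nonneg (fun _ _ => norm_nonneg _), ofReal_norm,
        Finset.sum_congr rfl fun j _ => ofReal_norm _] at h2
    calc _ ≤ _ := pow_le_pow_left' h1 2
      _ ≤ ENNReal.ofReal (K / r) ^ 2 * (4 * (‖v (spherePoint i σ r y)‖ₑ ^ 2 +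
          ∑ j, ‖Omega i (i.succAbove j) v (spherePoint i σ r y)‖ₑ ^ 2)) := by
        rw [mul_pow]
        gcongr
        exact sq_add_sum_le _ _
      _ ≤ _ := by
        rw [← mul_assoc, angEnergy]
        gcongr
        generalize spherePoint i σ r y = p
        calc _ ≤ ∑ j, ‖Omega i j v p‖ₑ ^ 2 := by
              rw [Fin.sum_univ_succAbove _ i]
              exact le_add_self
          _ ≤ _ := Finset.single_le_sum
            (f := fun k => ∑ j, ‖Omega k j v p‖ₑ ^ 2)
            (fun _ _ => bot_le) (Finset.mem_univ i)
  · rw [(cap_eventuallyEq_zero i σ hr v (not_le.1 hy)).fderiv_eq, fderiv_const_apply,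
      ← ofReal_norm, norm_zero, ENNReal.ofReal_zero, zero_pow two_ne_zero]
    exact bot_le

lemma eLpNorm_two_sq {α F : Type*} [MeasurableSpace α] {ν : Measure α} [NormedAddCommGroup F]
    (u : α → F) : eLpNorm u 2 ν ^ 2 = ∫⁻ x, ‖u x‖ₑ ^ 2 ∂ν := by
  have h := eLpNorm_nnreal_pow_eq_lintegral (f := u) (μ := ν) (p := 2) (by norm_num)
  norm_num at h
  exact h

lemma exists_eLpNorm_cap_le {q : ℝ} (hq : 1 ≤ q) (hq3 : q ≤ 3) : ∃ C : ℝ≥0∞, C ≠ ∞ ∧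
    ∀ (i : Fin 4) {σ r : ℝ}, σ ^ 2 = 1 → 0 < r → ∀ {v : Sp → ℂ}, ContDiff ℝ 1 v →
      eLpNorm (cap i σ r v) (ENNReal.ofReal (2 * q)) volume ^ 2 ≤
        C * ENNReal.ofReal (r ^ (-(3 * (1 - 1 / q)))) * capEnergy i σ r v := by
  obtain ⟨K, hK0, hK⟩ := exists_lintegral_fderiv_cap_sq_le
  set S := SNormLESNormFDerivOfEqConst ℂ (volume : Measure (Fin 3 → ℝ)) 2 with hS
  refine ⟨(S : ℝ≥0∞) ^ 2 * ENNReal.ofReal (K ^ 2 * 4 * 2 ^ (3 / q - 1)), by finiteness,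
    fun i σ r hσ hr v hv => ?_⟩
  have hsob : eLpNorm (cap i σ r v) 6 volume ≤ S * eLpNorm (fderiv ℝ (cap i σ r v)) 2 volume := by
    have := eLpNorm_le_eLpNorm_fderiv_of_eq volume (contDiff_cap i σ hr hv)
      (hasCompactSupport_cap i σ hr v) (p := 2) (p' := 6) (by norm_num) (by simp) (by norm_num)
    exact this
  have hsupp : (cap i σ r v).support ⊆ Set.Icc (fun _ => -r) (fun _ => r) := by
    intro y hy
    have h1 : ∑ j, y j ^ 2 ≤ r ^ 2 := by
      by_contra! h
      exact hy (cap_eq_zero i σ hr v (by nlinarith))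
    exact ⟨fun j => (abs_le.1 (abs_le_of_sum_sq_le hr.le h1 j)).1,
      fun j => (abs_le.1 (abs_le_of_sum_sq_le hr.le h1 j)).2⟩
  have hvol : (volume.restrict (Set.Icc (fun _ : Fin 3 => -r) (fun _ => r))) Set.univ =
      ENNReal.ofReal ((2 * r) ^ 3) := by
    rw [Measure.restrict_apply_univ, Real.volume_Icc_pi, ENNReal.ofReal_pow (by positivity)]
    simp [two_mul]
  have hhol : eLpNorm (cap i σ r v) (ENNReal.ofReal (2 * q)) volume ≤
      eLpNorm (cap i σ r v) 6 volume * ENNReal.ofReal (((2 * r) ^ 3) ^ (1 / (2 * q) - 1 / 6)) := by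
    rw [← eLpNorm_restrict_eq_of_support_subset hsupp,
      ← eLpNorm_restrict_eq_of_support_subset (p := 6) hsupp]
    refine (eLpNorm_le_eLpNorm_mul_rpow_measure_univ (q := 6) ?_
      (contDiff_cap i σ hr hv).continuous.aestronglyMeasurable).trans ?_
    · rw [show (6 : ℝ≥0∞) = ENNReal.ofReal 6 by norm_num]
      exact ENNReal.ofReal_le_ofReal (by linarith)
    · rw [hvol, ENNReal.toReal_ofReal (by linarith), ENNReal.ofReal_rpow_of_pos (by positivity)]
      norm_num
  have hreal : (K / r) ^ 2 * 4 * (((2 * r) ^ 3) ^ (1 / (2 * q) - 1 / 6)) ^ 2 =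
      K ^ 2 * 4 * 2 ^ (3 / q - 1) * r ^ (-(3 * (1 - 1 / q))) := by
    have h2r : (0 : ℝ) < 2 * r := by positivity
    rw [← Real.rpow_natCast (2 * r) 3, ← Real.rpow_mul h2r.le, ← Real.rpow_natCast (_ ^ (_ : ℝ)) 2,
      ← Real.rpow_mul h2r.le, Real.mul_rpow (by norm_num) hr.le, div_pow,
      ← Real.rpow_natCast r 2]
    have e1 : ((3 : ℕ) : ℝ) * (1 / (2 * q) - 1 / 6) * ((2 : ℕ) : ℝ) = 3 / q - 1 := by
      field_simp; push_cast; ring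
    have e2 : -(3 * (1 - 1 / q)) = (3 / q - 1) - ((2 : ℕ) : ℝ) := by
      push_cast; ring
    rw [e1, e2, Real.rpow_sub hr (3 / q - 1)]
    ring
  calc _ ≤ ((S * eLpNorm (fderiv ℝ (cap i σ r v)) 2 volume) *
        ENNReal.ofReal (((2 * r) ^ 3) ^ (1 / (2 * q) - 1 / 6))) ^ 2 := by
        gcongr
        exact hhol.trans (by gcongr)
    _ = (S : ℝ≥0∞) ^ 2 * (∫⁻ y, ‖fderiv ℝ (cap i σ r v) y‖ₑ ^ 2) *
        ENNReal.ofReal (((2 * r) ^ 3) ^ (1 / (2 * q) - 1 / 6)) ^ 2 := by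
        rw [mul_pow, mul_pow, eLpNorm_two_sq]
    _ ≤ (S : ℝ≥0∞) ^ 2 * (ENNReal.ofReal (K / r) ^ 2 * 4 * capEnergy i σ r v) *
        ENNReal.ofReal (((2 * r) ^ 3) ^ (1 / (2 * q) - 1 / 6)) ^ 2 := by
        gcongr
        exact hK i hσ hr hv
    _ = (S : ℝ≥0∞) ^ 2 * (ENNReal.ofReal (K / r) ^ 2 * ENNReal.ofReal 4 *
        ENNReal.ofReal (((2 * r) ^ 3) ^ (1 / (2 * q) - 1 / 6)) ^ 2) * capEnergy i σ r v := by
        rw [show ENNReal.ofReal 4 = 4 by norm_num]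
        ring
    _ = _ := by
        rw [← ENNReal.ofReal_pow (by positivity), ← ENNReal.ofReal_pow (by positivity),
          ← ENNReal.ofReal_mul (by positivity), ← ENNReal.ofReal_mul (by positivity), hreal,
          ENNReal.ofReal_mul (by positivity)]
        ring

lemma tsum_rpow_le_rpow_tsum {ι : Type*} {q : ℝ} (hq : 1 ≤ q) (b : ι → ℝ≥0∞) :
    ∑' a, b a ^ q ≤ (∑' a, b a) ^ q := by
  have h : ∀ x : ℝ≥0∞, x ^ q = x * x ^ (q - 1) := fun x => by
    nth_rewrite 2 [← ENNReal.rpow_one x]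
    rw [← ENNReal.rpow_add_of_nonneg _ _ zero_le_one (by linarith)]
    congr 1; ring
  rw [h (∑' a, b a), ← ENNReal.tsum_mul_right]
  refine ENNReal.tsum_le_tsum fun a => ?_
  rw [h]
  gcongr
  exact ENNReal.le_tsum a

lemma tsum_setLIntegral_le {α ι : Type*} [MeasurableSpace α] {ν : Measure α} [Countable ι]
    {D : ι → Set α} (hD : ∀ a, MeasurableSet (D a)) (hd : Pairwise (Function.onFun Disjoint D))
    (w : α → ℝ≥0∞) : ∑' a, ∫⁻ y in D a, w y ∂ν ≤ ∫⁻ y, w y ∂ν := by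
  rw [← lintegral_iUnion hD hd]
  exact setLIntegral_le_lintegral _ _

lemma tsum_setLIntegral_sq_rpow_le {α ι : Type*} [MeasurableSpace α] {ν : Measure α} [Countable ι]
    {q : ℝ} (hq : 1 ≤ q) {D : ι → Set α} (hD : ∀ a, MeasurableSet (D a))
    (hd : Pairwise (Function.onFun Disjoint D)) {V : ℝ≥0∞} (hV : ∀ a, ν (D a) ≤ V)
    {u : α → ℂ} (hu : AEStronglyMeasurable u ν) :
    (∑' a, (∫⁻ y in D a, ‖u y‖ₑ ^ 2 ∂ν) ^ q) ^ (1 / q) ≤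
      V ^ (1 - 1 / q) * eLpNorm u (ENNReal.ofReal (2 * q)) ν ^ 2 := by
  have hq0 : 0 < q := by linarith
  have hp0 : ENNReal.ofReal (2 * q) ≠ 0 := by
    rw [Ne, ENNReal.ofReal_eq_zero]; linarith
  have hpow : ∀ ρ : Measure α, eLpNorm u (ENNReal.ofReal (2 * q)) ρ ^ (2 * q) =
      ∫⁻ y, ‖u y‖ₑ ^ (2 * q) ∂ρ := fun ρ => by
    rw [eLpNorm_eq_lintegral_rpow_enorm_toReal hp0 ENNReal.ofReal_ne_top,
      ENNReal.toReal_ofReal (by linarith), ← ENNReal.rpow_mul,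
      one_div_mul_cancel (by linarith), ENNReal.rpow_one]
  have h1 : ∀ a, (∫⁻ y in D a, ‖u y‖ₑ ^ 2 ∂ν) ^ q ≤
      V ^ (q - 1) * ∫⁻ y in D a, ‖u y‖ₑ ^ (2 * q) ∂ν := fun a => by
    have h2 := eLpNorm_le_eLpNorm_mul_rpow_measure_univ (p := 2) (q := ENNReal.ofReal (2 * q))
      (μ := ν.restrict (D a)) (f := u) ?_ hu.restrict
    · rw [← eLpNorm_two_sq, ← ENNReal.rpow_natCast, ← ENNReal.rpow_mul, ← hpow]
      refine (ENNReal.rpow_le_rpow h2 (by positivity)).trans ?_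
      rw [ENNReal.mul_rpow_of_nonneg _ _ (by positivity), mul_comm, ← ENNReal.rpow_mul,
        ENNReal.toReal_ofReal (by linarith), Measure.restrict_apply_univ]
      push_cast
      gcongr
      have e : (1 / (2 : ℝ≥0∞).toReal - 1 / (2 * q)) * (2 * q) = q - 1 := by
        norm_num
        field_simp
      rw [e]
      exact ENNReal.rpow_le_rpow (hV a) (by linarith)
    · rw [show (2 : ℝ≥0∞) = ENNReal.ofReal 2 by norm_num]
      exact ENNReal.ofReal_le_ofReal (by linarith)
  calc _ ≤ (V ^ (q - 1) * eLpNorm u (ENNReal.ofReal (2 * q)) ν ^ (2 * q)) ^ (1 / q) := by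
        refine ENNReal.rpow_le_rpow ?_ (by positivity)
        refine (ENNReal.tsum_le_tsum h1).trans ?_
        rw [ENNReal.tsum_mul_left, hpow]
        gcongr
        exact tsum_setLIntegral_le hD hd _
    _ = _ := by
        rw [ENNReal.mul_rpow_of_nonneg _ _ (by positivity), ← ENNReal.rpow_mul, ← ENNReal.rpow_mul,
          ← ENNReal.rpow_natCast]
        congr 2
        · field_simp
        · field_simp; push_cast; ring

lemma measurableSet_cube (μ : ℝ) (a : Fin 4 → ℤ) : MeasurableSet (cube μ a) := by
  unfold cube
  rw [Set.ofPred_forall]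
  refine MeasurableSet.iInter fun i => ?_
  exact (measurableSet_le measurable_const
      (by fun_prop : Measurable fun x : Sp => μ * x i)).inter
    (measurableSet_lt (by fun_prop : Measurable fun x : Sp => μ * x i) measurable_const)

lemma pairwise_disjoint_cube (μ : ℝ) : Pairwise (Function.onFun Disjoint (cube μ)) := by
  intro a a' h
  rw [Function.onFun, Set.disjoint_left]
  intro x hx hx'
  refine h (funext fun i => ?_)
  have h1 := hx i
  have h2 := hx' i
  have h3 : (a i : ℝ) < a' i + 1 := by linarith
  have h4 : (a' i : ℝ) < a i + 1 := by linarith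
  norm_cast at h3 h4
  lia

/-- The graph coordinates of the part of a lattice cube and a sector on the sphere of radius
`r`. -/
def spherePiece (μ : ℝ) (k : Fin 4 × Bool) (a : Fin 4 → ℤ) (r : ℝ) : Set (Fin 3 → ℝ) :=
  {y | ∑ j, y j ^ 2 < r ^ 2 ∧ spherePoint k.1 (bsign k.2) r y ∈ cube μ a ∩ sector k}

lemma measurableSet_spherePiece_prod (μ : ℝ) (k : Fin 4 × Bool) (a : Fin 4 → ℤ) :
    MeasurableSet {p : ℝ × (Fin 3 → ℝ) | p.2 ∈ spherePiece μ k a p.1} := by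
  refine (measurableSet_lt (by fun_prop : Measurable fun p : ℝ × (Fin 3 → ℝ) => ∑ j, p.2 j ^ 2)
    (by fun_prop : Measurable fun p : ℝ × (Fin 3 → ℝ) => p.1 ^ 2)).inter ?_
  exact (continuous_spherePoint k.1 (bsign k.2)).measurable
    ((measurableSet_cube μ a).inter (isClosed_sector k).measurableSet)

lemma measurableSet_spherePiece (μ : ℝ) (k : Fin 4 × Bool) (a : Fin 4 → ℤ) (r : ℝ) :
    MeasurableSet (spherePiece μ k a r) :=
  measurable_prodMk_left (x := r) (measurableSet_spherePiece_prod μ k a)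

lemma pairwise_disjoint_spherePiece (μ : ℝ) (k : Fin 4 × Bool) (r : ℝ) :
    Pairwise (Function.onFun Disjoint fun a => spherePiece μ k a r) := by
  intro a a' h
  rw [Function.onFun, Set.disjoint_left]
  intro y hy hy'
  exact Set.disjoint_left.1 (pairwise_disjoint_cube μ h) hy.2.1 hy'.2.1

lemma volume_spherePiece_le {μ : ℝ} (hμ : 0 < μ) (k : Fin 4 × Bool) (a : Fin 4 → ℤ) (r : ℝ) :
    volume (spherePiece μ k a r) ≤ ENNReal.ofReal (μ⁻¹ ^ 3) := by
  have h : spherePiece μ k a r ⊆ Set.pi Set.univ fun j : Fin 3 =>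
      Set.Ico ((a (k.1.succAbove j) : ℝ) / μ) ((a (k.1.succAbove j) + 1) / μ) := by
    intro y hy j _
    have h1 := hy.2.1 (k.1.succAbove j)
    rw [spherePoint, ins_succAbove] at h1
    exact ⟨by rw [div_le_iff₀ hμ]; linarith, by rw [lt_div_iff₀ hμ]; linarith⟩
  refine (measure_mono h).trans ?_
  rw [Real.volume_pi_Ico, ENNReal.ofReal_pow (inv_pos.2 hμ).le]
  simp [← sub_div]

lemma sum_sq_le_of_mem_spherePiece {μ r : ℝ} (hr : 0 ≤ r) {k : Fin 4 × Bool} {a : Fin 4 → ℤ}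
    {y : Fin 3 → ℝ} (hy : y ∈ spherePiece μ k a r) : ∑ j, y j ^ 2 ≤ 3 / 4 * r ^ 2 := by
  have h1 := hy.2.2
  have h2 := norm_spherePoint k.1 (bsign_sq k.2) hr hy.1.le
  rw [sector, Set.mem_ofPred_eq, h2, spherePoint, ins_same, ← mul_assoc (bsign _), ← sq, bsign_sq,
    one_mul] at h1
  have h3 := Real.sq_sqrt (sub_nonneg.2 hy.1.le)
  nlinarith

lemma min_one_rpow_le {x β : ℝ} (hx : 0 < x) (hβ : 0 ≤ β) :
    min 1 (x ^ (-β)) ≤ 2 ^ β * (1 + x) ^ (-β) := by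
  have h : ∀ z : ℝ, 0 < z → (1 + x) ≤ 2 * z → z ^ (-β) ≤ 2 ^ β * (1 + x) ^ (-β) := by
    intro z hz hxz
    have h1 := Real.rpow_le_rpow_of_nonpos (by positivity) hxz (neg_nonpos.2 hβ)
    rw [Real.mul_rpow (by norm_num) hz.le, Real.rpow_neg (by norm_num),
      inv_mul_le_iff₀ (by positivity)] at h1
    exact h1
  rcases le_total x 1 with h1 | h1
  · refine (min_le_left _ _).trans ?_
    simpa using h 1 one_pos (by linarith)
  · exact (min_le_right _ _).trans (h x hx (by linarith))

lemma exists_tsum_spherePiece_le {q : ℝ} (hq : 1 ≤ q) (hq3 : q ≤ 3) : ∃ C : ℝ≥0∞, C ≠ ∞ ∧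
    ∀ {μ : ℝ}, 0 < μ → ∀ (k : Fin 4 × Bool) {r : ℝ}, 0 < r → ∀ {v : Sp → ℂ}, ContDiff ℝ 1 v →
      (∑' a, (∫⁻ y in spherePiece μ k a r,
        ‖v (spherePoint k.1 (bsign k.2) r y)‖ₑ ^ 2) ^ q) ^ (1 / q) ≤
        C * ENNReal.ofReal ((1 + μ * r) ^ (-(3 * (1 - 1 / q)))) *
          capEnergy k.1 (bsign k.2) r v := by
  obtain ⟨C, hC, hcap⟩ := exists_eLpNorm_cap_le hq hq3
  have hq0 : 0 < q := by linarith
  set β := 3 * (1 - 1 / q) with hβ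
  have hβ0 : 0 ≤ β := by
    have : 1 / q ≤ 1 := by rw [div_le_one hq0]; exact hq
    rw [hβ]; linarith
  refine ⟨(1 + C) * ENNReal.ofReal (2 ^ β), by finiteness, fun {μ} hμ k {r} hr {v} hv => ?_⟩
  set E := capEnergy k.1 (bsign k.2) r v with hE
  have hb : ∀ a, ∫⁻ y in spherePiece μ k a r, ‖v (spherePoint k.1 (bsign k.2) r y)‖ₑ ^ 2 =
      ∫⁻ y in spherePiece μ k a r, ‖cap k.1 (bsign k.2) r v y‖ₑ ^ 2 := fun a => by
    refine setLIntegral_congr_fun (measurableSet_spherePiece μ k a r) fun y hy => ?_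
    simp only [cap_eq k.1 (bsign k.2) hr v (sum_sq_le_of_mem_spherePiece hr.le hy)]
  simp_rw [hb]
  have h1 : (∑' a, (∫⁻ y in spherePiece μ k a r, ‖cap k.1 (bsign k.2) r v y‖ₑ ^ 2) ^ q) ^ (1 / q)
      ≤ E := by
    rw [one_div, ENNReal.rpow_inv_le_iff hq0]
    refine (tsum_rpow_le_rpow_tsum hq _).trans (ENNReal.rpow_le_rpow ?_ hq0.le)
    exact (tsum_setLIntegral_le (measurableSet_spherePiece μ k · r)
      (pairwise_disjoint_spherePiece μ k r) _).trans (lintegral_cap_sq_le _ _ hr v)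
  have h2 : (∑' a, (∫⁻ y in spherePiece μ k a r, ‖cap k.1 (bsign k.2) r v y‖ₑ ^ 2) ^ q) ^ (1 / q)
      ≤ C * ENNReal.ofReal ((μ * r) ^ (-β)) * E := by
    refine (tsum_setLIntegral_sq_rpow_le hq (measurableSet_spherePiece μ k · r)
      (pairwise_disjoint_spherePiece μ k r) (volume_spherePiece_le hμ k · r)
      (contDiff_cap _ _ hr hv).continuous.aestronglyMeasurable).trans ?_
    refine (mul_le_mul_right (hcap k.1 (bsign_sq k.2) hr hv) _).trans (le_of_eq ?_)
    have e : (μ⁻¹ ^ 3) ^ (1 - 1 / q) = μ ^ (-β) := by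
      rw [← Real.rpow_natCast, ← Real.rpow_mul (by positivity), Real.inv_rpow hμ.le,
        Real.rpow_neg hμ.le]
      norm_num [hβ]
    rw [ENNReal.ofReal_rpow_of_pos (by positivity), e, Real.mul_rpow hμ.le hr.le,
      ENNReal.ofReal_mul (by positivity)]
    ring
  have h3 := min_one_rpow_le (mul_pos hμ hr) hβ0
  have h4 : ENNReal.ofReal (min 1 ((μ * r) ^ (-β))) ≤
      ENNReal.ofReal (2 ^ β) * ENNReal.ofReal ((1 + μ * r) ^ (-β)) := by
    rw [← ENNReal.ofReal_mul (by positivity)]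
    exact ENNReal.ofReal_le_ofReal h3
  calc _ ≤ (1 + C) * ENNReal.ofReal (min 1 ((μ * r) ^ (-β))) * E := by
        rcases min_choice 1 ((μ * r) ^ (-β)) with h | h
        · rw [h, ENNReal.ofReal_one, mul_one, add_mul, one_mul]
          exact h1.trans le_self_add
        · rw [h]
          refine h2.trans ?_
          gcongr
          exact le_add_self
    _ ≤ (1 + C) * (ENNReal.ofReal (2 ^ β) * ENNReal.ofReal ((1 + μ * r) ^ (-β))) * E := by gcongr
    _ = _ := by ring

lemma setLIntegral_sector_le (μ : ℝ) (k : Fin 4 × Bool) (a : Fin 4 → ℤ) {v : Sp → ℂ}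
    (hv : Continuous v) : ∫⁻ x in cube μ a ∩ sector k, ‖v x‖ₑ ^ 2 ≤
      2 * ∫⁻ r in Set.Ioi 0, ∫⁻ y in spherePiece μ k a r,
        ‖v (spherePoint k.1 (bsign k.2) r y)‖ₑ ^ 2 := by
  have hms : MeasurableSet (cube μ a ∩ sector k) :=
    (measurableSet_cube μ a).inter (isClosed_sector k).measurableSet
  have hH : MeasurableSet {x : Sp | 0 < bsign k.2 * x k.1} :=
    measurableSet_lt measurable_const (by fun_prop)
  have hmw : Measurable ((cube μ a ∩ sector k).indicator fun x => ‖v x‖ₑ ^ 2) :=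
    (by have := hv.measurable; fun_prop : Measurable fun x => ‖v x‖ₑ ^ 2).indicator hms
  calc _ = ∫⁻ x, (cube μ a ∩ sector k).indicator (fun x => ‖v x‖ₑ ^ 2) x :=
        (lintegral_indicator hms _).symm
    _ ≤ ∫⁻ x in {x : Sp | 0 < bsign k.2 * x k.1},
          (cube μ a ∩ sector k).indicator (fun x => ‖v x‖ₑ ^ 2) x := by
        rw [← lintegral_indicator hH]
        refine lintegral_mono_ae ?_
        filter_upwards [compl_mem_ae_iff.2 (measure_singleton (μ := volume) (0 : Sp))] with x hx
        by_cases hxs : x ∈ cube μ a ∩ sector k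
        · rw [Set.indicator_of_mem (s := {x : Sp | 0 < bsign k.2 * x k.1})]
          have h1 : ‖x‖ ≤ 2 * (bsign k.2 * x k.1) := hxs.2
          have h2 : 0 < ‖x‖ := norm_pos_iff.2 hx
          exact (by linarith : 0 < bsign k.2 * x k.1)
        · rw [Set.indicator_of_notMem hxs]
          exact bot_le
    _ ≤ ∫⁻ r in Set.Ioi 0, 2 * ∫⁻ y in spherePiece μ k a r,
        ‖v (spherePoint k.1 (bsign k.2) r y)‖ₑ ^ 2 := by
        rw [lintegral_halfSpace_eq k.1 (bsign_sq k.2) hmw]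
        refine setLIntegral_mono' measurableSet_Ioi fun r hr => ?_
        have hr : 0 < r := hr
        rw [← lintegral_const_mul' _ _ (by simp),
          ← lintegral_indicator (measurableSet_spherePiece μ k a r),
          ← lintegral_indicator (measurableSet_lt (by fun_prop) measurable_const)]
        refine lintegral_mono fun y => ?_
        by_cases hy : y ∈ spherePiece μ k a r
        · rw [Set.indicator_of_mem hy, Set.indicator_of_mem (by exact hy.1),
            Set.indicator_of_mem hy.2]
          gcongr
          rw [show (2 : ℝ≥0∞) = ENNReal.ofReal 2 by norm_num]
          refine ENNReal.ofReal_le_ofReal ?_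
          have h3 : r / 2 ≤ √(r ^ 2 - ∑ j, y j ^ 2) := by
            refine Real.le_sqrt_of_sq_le ?_
            have := sum_sq_le_of_mem_spherePiece hr.le hy
            nlinarith
          rw [div_le_iff₀ (lt_of_lt_of_le (by positivity) h3)]
          linarith
        · by_cases hy1 : ∑ j, y j ^ 2 < r ^ 2
          · rw [Set.indicator_of_mem (by exact hy1),
              Set.indicator_of_notMem (fun h => hy ⟨hy1, h⟩), mul_zero]
            exact bot_le
          · rw [Set.indicator_of_notMem (by exact hy1)]
            exact bot_le
    _ = _ := lintegral_const_mul' _ _ (by simp)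

lemma lintegral_capEnergy_le (i : Fin 4) {σ : ℝ} (hσ : σ ^ 2 = 1) {W : ℝ → ℝ≥0∞}
    (hW : Measurable W) {v : Sp → ℂ} (hv : ContDiff ℝ 1 v) :
    ∫⁻ r in Set.Ioi 0, W r * capEnergy i σ r v ≤ ∫⁻ x, W ‖x‖ * angEnergy v x := by
  have hmw : Measurable fun x : Sp => W ‖x‖ * angEnergy v x :=
    (hW.comp measurable_norm).mul (measurable_angEnergy hv)
  refine le_trans ?_ (setLIntegral_le_lintegral {x : Sp | 0 < σ * x i} _)
  rw [lintegral_halfSpace_eq i hσ hmw]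
  refine setLIntegral_mono' measurableSet_Ioi fun r hr => ?_
  have hr : 0 < r := hr
  have hmP : Measurable fun y : Fin 3 → ℝ => angEnergy v (spherePoint i σ r y) :=
    (measurable_angEnergy hv).comp ((continuous_spherePoint i σ).comp
      (f := fun y : Fin 3 → ℝ => (r, y)) (by fun_prop)).measurable
  rw [capEnergy, ← lintegral_const_mul _ hmP, ← lintegral_indicator (measurableSet_capDomain r),
    ← lintegral_indicator (measurableSet_lt (by fun_prop) measurable_const)]
  refine lintegral_mono fun y => ?_
  by_cases hy : ∑ j, y j ^ 2 ≤ 7 / 8 * r ^ 2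
  · have hy1 : ∑ j, y j ^ 2 < r ^ 2 := by nlinarith
    rw [Set.indicator_of_mem (by exact hy), Set.indicator_of_mem (by exact hy1),
      norm_spherePoint i hσ hr.le hy1.le]
    refine le_mul_of_one_le_left bot_le ?_
    rw [← ENNReal.ofReal_one]
    refine ENNReal.ofReal_le_ofReal ?_
    rw [one_le_div (Real.sqrt_pos.2 (by linarith)), Real.sqrt_le_left hr.le]
    have : 0 ≤ ∑ j, y j ^ 2 := by positivity
    linarith
  · rw [Set.indicator_of_notMem (by exact hy)]
    exact bot_le

/-- Sobolev on spheres gives `ℓ^q(L²)` control over cubes, with a decaying radial weight. -/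
lemma exists_tsum_cube_le {q : ℝ} (hq : 1 < q) (hq3 : q ≤ 3) : ∃ C : ℝ≥0∞, C ≠ ∞ ∧
    ∀ {μ : ℝ}, 0 < μ → ∀ {v : Sp → ℂ}, ContDiff ℝ 1 v →
      (∑' a, (∫⁻ x in cube μ a, ‖v x‖ₑ ^ 2) ^ q) ^ (1 / q) ≤
        C * ∫⁻ x, ENNReal.ofReal ((1 + μ * ‖x‖) ^ (-(3 * (1 - 1 / q)))) * angEnergy v x := by
  obtain ⟨C, hC, hpiece⟩ := exists_tsum_spherePiece_le hq.le hq3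
  have hq0 : 0 < q := by linarith
  refine ⟨8 * (2 * C), by finiteness, fun {μ} hμ {v} hv => ?_⟩
  set I := ∫⁻ x, ENNReal.ofReal ((1 + μ * ‖x‖) ^ (-(3 * (1 - 1 / q)))) * angEnergy v x with hI
  have hsec : ∀ k : Fin 4 × Bool, ∑' a, (∫⁻ x in cube μ a ∩ sector k, ‖v x‖ₑ ^ 2) ^ q ≤
      (2 * C * I) ^ q := fun k => by
    set b : (Fin 4 → ℤ) → ℝ → ℝ≥0∞ := fun a r => ∫⁻ y in spherePiece μ k a r,
        ‖v (spherePoint k.1 (bsign k.2) r y)‖ₑ ^ 2 with hb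
    have hbm : ∀ a, Measurable (b a) := fun a => by
      have h1 : Measurable fun p : ℝ × (Fin 3 → ℝ) =>
          ‖v (spherePoint k.1 (bsign k.2) p.1 p.2)‖ₑ ^ 2 := by
        have := (hv.continuous.comp (continuous_spherePoint k.1 (bsign k.2))).measurable
        exact this.enorm.pow_const 2
      have h2 := (h1.indicator (measurableSet_spherePiece_prod μ k a)).lintegral_prod_right'
        (ν := volume)
      refine (congrArg Measurable (funext fun r => ?_)).mpr h2
      simp only [hb]
      rw [← lintegral_indicator (measurableSet_spherePiece μ k a r)]
      rfl
    calc _ ≤ ∑' a, (2 * ∫⁻ r in Set.Ioi 0, b a r) ^ q :=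
          ENNReal.tsum_le_tsum fun a => ENNReal.rpow_le_rpow
            (setLIntegral_sector_le μ k a hv.continuous) hq0.le
      _ = 2 ^ q * ∑' a, (∫⁻ r in Set.Ioi 0, b a r) ^ q := by
          simp_rw [ENNReal.mul_rpow_of_nonneg _ _ hq0.le]
          rw [ENNReal.tsum_mul_left]
      _ ≤ 2 ^ q * (∫⁻ r in Set.Ioi 0, (∑' a, b a r ^ q) ^ (1 / q)) ^ q := by
          gcongr
          exact tsum_lintegral_rpow_le hq hbm
      _ ≤ 2 ^ q * (C * I) ^ q := by
          gcongr
          calc _ ≤ ∫⁻ r in Set.Ioi 0, C * (ENNReal.ofReal ((1 + μ * r) ^ (-(3 * (1 - 1 / q)))) *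
                  capEnergy k.1 (bsign k.2) r v) := by
                refine setLIntegral_mono' measurableSet_Ioi fun r hr => ?_
                rw [← mul_assoc]
                exact hpiece hμ k hr hv
            _ = C * ∫⁻ r in Set.Ioi 0, ENNReal.ofReal ((1 + μ * r) ^ (-(3 * (1 - 1 / q)))) *
                  capEnergy k.1 (bsign k.2) r v := lintegral_const_mul' _ _ hC
            _ ≤ C * I := by
                gcongr
                exact lintegral_capEnergy_le k.1 (bsign_sq k.2)
                  (W := fun r => ENNReal.ofReal ((1 + μ * r) ^ (-(3 * (1 - 1 / q)))))
                  (by fun_prop) hv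
      _ = _ := by rw [← ENNReal.mul_rpow_of_nonneg _ _ hq0.le, mul_assoc]
  have hcube : ∀ a, ∫⁻ x in cube μ a, ‖v x‖ₑ ^ 2 ≤
      ∑ k : Fin 4 × Bool, ∫⁻ x in cube μ a ∩ sector k, ‖v x‖ₑ ^ 2 := fun a => by
    have h1 : cube μ a ⊆ ⋃ k, cube μ a ∩ sector k := fun x hx => by
      obtain ⟨k, hk⟩ := exists_mem_sector x
      exact Set.mem_iUnion.2 ⟨k, hx, hk⟩
    refine (lintegral_mono_set h1).trans ((lintegral_iUnion_le _ _).trans ?_)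
    rw [tsum_fintype]
  rw [one_div, ENNReal.rpow_inv_le_iff hq0]
  calc _ ≤ ∑' a, 8 ^ (q - 1) * ∑ k : Fin 4 × Bool,
          (∫⁻ x in cube μ a ∩ sector k, ‖v x‖ₑ ^ 2) ^ q := by
        refine ENNReal.tsum_le_tsum fun a => (ENNReal.rpow_le_rpow (hcube a) hq0.le).trans ?_
        have := ENNReal.rpow_sum_le_const_mul_sum_rpow (Finset.univ : Finset (Fin 4 × Bool))
          (fun k => ∫⁻ x in cube μ a ∩ sector k, ‖v x‖ₑ ^ 2) hq.le
        norm_num at this ⊢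
        exact this
    _ = 8 ^ (q - 1) * ∑ k : Fin 4 × Bool, ∑' a,
          (∫⁻ x in cube μ a ∩ sector k, ‖v x‖ₑ ^ 2) ^ q := by
        rw [ENNReal.tsum_mul_left]
        congr 1
        exact Summable.tsum_finsetSum fun _ _ => ENNReal.summable
    _ ≤ 8 ^ (q - 1) * ∑ k : Fin 4 × Bool, (2 * C * I) ^ q := by
        gcongr with k
        exact hsec k
    _ = (8 ^ (q - 1) * 8 ^ (1 : ℝ)) * (2 * C * I) ^ q := by
        simp [mul_assoc]
    _ = _ := by
        rw [← ENNReal.rpow_add _ _ (by norm_num) (by norm_num), sub_add_cancel,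
          ← ENNReal.mul_rpow_of_nonneg _ _ hq0.le]
        congr 1
        ring

lemma enorm_Omega_swap (i j : Fin 4) (v : Sp → ℂ) (x : Sp) :
    ‖Omega i j v x‖ₑ = ‖Omega j i v x‖ₑ := by
  rw [← enorm_neg]
  simp only [Omega, neg_sub]

lemma eLpNorm_Omega_le (i j : Fin 4) (v : Sp → ℂ) :
    eLpNorm (Omega i j v) 2 volume ≤ ∑ i : Fin 4, ∑ j : Fin 4,
      if i < j then eLpNorm (Omega i j v) 2 volume else 0 := by
  have key : ∀ a b : Fin 4, a < b → eLpNorm (Omega a b v) 2 volume ≤ ∑ i : Fin 4, ∑ j : Fin 4,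
      if i < j then eLpNorm (Omega i j v) 2 volume else 0 := fun a b hab => by
    refine le_trans ?_ (Finset.single_le_sum (f := fun i => ∑ j : Fin 4,
      if i < j then eLpNorm (Omega i j v) 2 volume else 0) (fun _ _ => bot_le) (Finset.mem_univ a))
    refine le_trans ?_ (Finset.single_le_sum (f := fun j : Fin 4 =>
      if a < j then eLpNorm (Omega a j v) 2 volume else 0) (fun _ _ => bot_le) (Finset.mem_univ b))
    simp [hab]
  rcases lt_trichotomy i j with h | rfl | h
  · exact key i j h
  · have h0 : Omega i i v = 0 := by ext x; simp [Omega]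
    simp [h0]
  · rw [eLpNorm_congr_enorm_ae (.of_forall (enorm_Omega_swap i j v))]
    exact key j i h

/-- A function together with its rotational derivatives. -/
def angFamily (f : SchwartzMap Sp ℂ) : Option (Fin 4 × Fin 4) → SchwartzMap Sp ℂ
  | none => f
  | some k => schwartzOmega k.1 k.2 f

lemma eLpNorm_angFamily_le (f : SchwartzMap Sp ℂ) (k : Option (Fin 4 × Fin 4)) :
    eLpNorm (angFamily f k) 2 volume ≤ eLpNorm (⇑f) 2 volume + ∑ i : Fin 4, ∑ j : Fin 4,
      if i < j then eLpNorm (Omega i j f) 2 volume else 0 := by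
  cases k with
  | none => exact le_self_add
  | some k =>
    refine le_trans ?_ le_add_self
    rw [angFamily, show (⇑(schwartzOmega k.1 k.2 f)) = Omega k.1 k.2 f from
      funext (schwartzOmega_apply k.1 k.2 f)]
    exact eLpNorm_Omega_le k.1 k.2 f

lemma angEnergy_halfWave {f : SchwartzMap Sp ℂ} (hf : UnitFrequency f) (t : ℝ) (x : Sp) :
    angEnergy (halfWave f t) x =
      ∑ k, ‖hw (𝓕 (angFamily f k) : SchwartzMap Sp ℂ) t x‖ₑ ^ 2 := by
  obtain ⟨v, hv, hO⟩ := exists_schwartz_halfWave hf t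
  rw [angEnergy, Fintype.sum_option, Fintype.sum_prod_type]
  congr 1
  simp_rw [← hv, hO]
  rfl

/-- The energy with weight `(1 + μ|x|)^{-β}`, `β > 1`, is integrable in time. -/
lemma exists_weighted_angEnergy_le {β : ℝ} (hβ : 1 < β) : ∃ D : ℝ≥0∞, D ≠ ∞ ∧
    ∀ {f : SchwartzMap Sp ℂ}, UnitFrequency f → ∀ {μ : ℝ}, 0 < μ →
      ∫⁻ t, ∫⁻ x, ENNReal.ofReal ((1 + μ * ‖x‖) ^ (-β)) * angEnergy (halfWave f t) x ≤
        D * ENNReal.ofReal μ⁻¹ * (eLpNorm (⇑f) 2 volume + ∑ i : Fin 4, ∑ j : Fin 4,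
          if i < j then eLpNorm (Omega i j f) 2 volume else 0) ^ 2 := by
  refine ⟨17 * (64 * (ENNReal.ofReal (∫ s : ℝ, (1 + ‖s‖) ^ (-β)) *
    (2 * ENNReal.ofReal ((1 / 3 : ℝ)⁻¹ ^ 4)))), by finiteness, fun {f} hf {μ} hμ => ?_⟩
  set N := eLpNorm (⇑f) 2 volume + ∑ i : Fin 4, ∑ j : Fin 4,
          if i < j then eLpNorm (Omega i j f) 2 volume else 0 with hN
  have hWm : Measurable fun x : Sp => ENNReal.ofReal ((1 + μ * ‖x‖) ^ (-β)) := by fun_prop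
  calc _ = ∫⁻ t, ∫⁻ x, ∑ k, 1 * (ENNReal.ofReal ((1 + μ * ‖x‖) ^ (-β)) *
          ‖hw (𝓕 (angFamily f k) : SchwartzMap Sp ℂ) t x‖ₑ ^ 2) := by
        simp_rw [angEnergy_halfWave hf, Finset.mul_sum, one_mul]
    _ = ∑ k, 1 * ∫⁻ t, ∫⁻ x, ENNReal.ofReal ((1 + μ * ‖x‖) ^ (-β)) *
          ‖hw (𝓕 (angFamily f k) : SchwartzMap Sp ℂ) t x‖ₑ ^ 2 :=
        lintegral_lintegral_sum_const_mul (by norm_num) (fun k t x =>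
          ENNReal.ofReal ((1 + μ * ‖x‖) ^ (-β)) *
            ‖hw (𝓕 (angFamily f k) : SchwartzMap Sp ℂ) t x‖ₑ ^ 2) fun k =>
          (hWm.comp measurable_snd).mul
            ((measurable_hw (SchwartzMap.continuous _).measurable).enorm.pow_const 2)
    _ ≤ ∑ _k : Option (Fin 4 × Fin 4), 64 * (ENNReal.ofReal μ⁻¹ *
          ENNReal.ofReal (∫ s : ℝ, (1 + ‖s‖) ^ (-β)) *
            (2 * ENNReal.ofReal ((1 / 3 : ℝ)⁻¹ ^ 4) * N ^ 2)) := by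
        refine Finset.sum_le_sum fun k _ => ?_
        rw [one_mul]
        refine (weighted_energy_le hβ (SchwartzMap.continuous _).measurable
          (SchwartzMap.integrable _) hμ).trans ?_
        rw [lintegral_enorm_sq_fourier]
        gcongr
        exact eLpNorm_angFamily_le f k
    _ = _ := by
        rw [Finset.sum_const, Finset.card_univ, Fintype.card_option, Fintype.card_prod,
          Fintype.card_fin, nsmul_eq_mul]
        push_cast
        norm_num
        ring

lemma tsum_cubeNorm_rpow_le {q p : ℝ} (hq : 0 < q) (hp : 2 * q ≤ p) (μ : ℝ) (h : Sp → ℂ) :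
    (∑' a, cubeNorm μ a h ^ p) ^ (2 / p) ≤
      (∑' a, (∫⁻ x in cube μ a, ‖h x‖ₑ ^ 2) ^ q) ^ (1 / q) := by
  have hp0 : 0 < p := by linarith
  have h1 : ∀ a, cubeNorm μ a h ^ p =
      ((∫⁻ x in cube μ a, ‖h x‖ₑ ^ 2) ^ q) ^ (p / (2 * q)) := fun a => by
    have h2 : cubeNorm μ a h = (∫⁻ x in cube μ a, ‖h x‖ₑ ^ 2) ^ (1 / 2 : ℝ) := by
      unfold cubeNorm
      congr 2 with x
      rw [← ENNReal.rpow_natCast]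
      rfl
    rw [h2, ← ENNReal.rpow_mul, ← ENNReal.rpow_mul]
    congr 1
    field_simp
  simp_rw [h1]
  refine (ENNReal.rpow_le_rpow (tsum_rpow_le_rpow_tsum ?_ _) (by positivity)).trans (le_of_eq ?_)
  · rw [one_le_div (by positivity)]
    exact hp
  · rw [← ENNReal.rpow_mul]
    congr 1
    field_simp

/-- (Two-scale Strichartz estimate for angularly regular data; endpoint
case.)  For every `ε > 0` there is a constant `C_ε` such that, with `r = 3 + ε`, for any
unit-frequency Schwartz `f`, any `0 < μ ≤ 1`, and the partition of `ℝ⁴` into cubes `Q_α`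
of side `1/μ`, the half-wave evolution `u(t,x) = e^{it√(−Δ)}f(x)` satisfies
`(∫ (Σ_α ‖u(t,·)‖_{L²(Q_α)}^r)^{2/r} dt)^{1/2}
  ≤ C_ε μ^{−(1/2+ε)} (‖f‖_{L²} + Σ_{i<j} ‖Ω_{ij}f‖_{L²})`. -/
theorem statement9 (ε : ℝ) (hε : 0 < ε) :
    ∃ C : ℝ, 0 < C ∧ ∀ f : SchwartzMap Sp ℂ, UnitFrequency f →
      ∀ μ : ℝ, 0 < μ → μ ≤ 1 →
        (∫⁻ t : ℝ, (∑' a : Fin 4 → ℤ,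
            cubeNorm μ a (halfWave f t) ^ (3 + ε)) ^ (2/(3 + ε))) ^ (1/2 : ℝ) ≤
          ENNReal.ofReal C * ENNReal.ofReal (μ ^ (-(1/2 + ε))) *
            (eLpNorm (⇑f) 2 volume +
              ∑ i : Fin 4, ∑ j : Fin 4,
                if i < j then eLpNorm (Omega i j f) 2 volume else 0) := by
  obtain ⟨q, hq, hq3, hqε⟩ : ∃ q : ℝ, 3 / 2 < q ∧ q ≤ 3 ∧ 2 * q ≤ 3 + ε :=
    ⟨(3 + min ε 3) / 2, by have : 0 < min ε 3 := by positivity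
                           linarith, by linarith [min_le_right ε 3], by linarith [min_le_left ε 3]⟩
  have hq0 : 0 < q := by linarith
  have hβ : 1 < 3 * (1 - 1 / q) := by
    have : 1 / q < 2 / 3 := by rw [div_lt_iff₀ hq0]; linarith
    linarith
  obtain ⟨A, hA, hcube⟩ := exists_tsum_cube_le (by linarith : 1 < q) hq3
  obtain ⟨D, hD, henergy⟩ := exists_weighted_angEnergy_le hβ
  have hfin : (A * D) ^ (1 / 2 : ℝ) ≠ ∞ :=
    ENNReal.rpow_ne_top_of_nonneg (by norm_num) (ENNReal.mul_ne_top hA hD)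
  refine ⟨((A * D) ^ (1 / 2 : ℝ)).toReal + 1, by positivity, fun f hf μ hμ hμ1 => ?_⟩
  set N := eLpNorm (⇑f) 2 volume + ∑ i : Fin 4, ∑ j : Fin 4,
    if i < j then eLpNorm (Omega i j f) 2 volume else 0 with hN
  have hL : ∫⁻ t : ℝ, (∑' a, cubeNorm μ a (halfWave f t) ^ (3 + ε)) ^ (2 / (3 + ε)) ≤
      A * D * ENNReal.ofReal μ⁻¹ * N ^ 2 := by
    calc _ ≤ ∫⁻ t, A * ∫⁻ x, ENNReal.ofReal ((1 + μ * ‖x‖) ^ (-(3 * (1 - 1 / q)))) *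
            angEnergy (halfWave f t) x := by
          refine lintegral_mono fun t => (tsum_cubeNorm_rpow_le hq0 hqε μ _).trans ?_
          obtain ⟨v, hv, -⟩ := exists_schwartz_halfWave hf t
          exact hcube hμ (hv ▸ v.smooth 1)
      _ = A * ∫⁻ t, ∫⁻ x, ENNReal.ofReal ((1 + μ * ‖x‖) ^ (-(3 * (1 - 1 / q)))) *
            angEnergy (halfWave f t) x := lintegral_const_mul' _ _ hA
      _ ≤ A * (D * ENNReal.ofReal μ⁻¹ * N ^ 2) := by
          gcongr
          exact henergy hf hμ
      _ = _ := by ring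
  refine (ENNReal.rpow_le_rpow hL (by norm_num)).trans ?_
  rw [ENNReal.mul_rpow_of_nonneg _ _ (by norm_num), ENNReal.mul_rpow_of_nonneg _ _ (by norm_num),
    ← ENNReal.rpow_natCast, ← ENNReal.rpow_mul]
  norm_num only [Nat.cast_ofNat, ENNReal.rpow_one]
  gcongr
  · rw [ENNReal.ofReal_add (by positivity) zero_le_one]
    refine le_trans ?_ le_self_add
    rw [ENNReal.ofReal_toReal hfin]
  · rw [ENNReal.ofReal_rpow_of_pos (by positivity)]
    refine ENNReal.ofReal_le_ofReal ?_
    rw [Real.inv_rpow hμ.le, ← Real.rpow_neg hμ.le]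
    exact Real.rpow_le_rpow_of_exponent_ge hμ hμ1 (by linarith)

end
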